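/- arXiv:1701.02974 — 3 statements merged into one kernel-verified Lean document; each statement's English description precedes it below -/
import Mathlib

section
/- For every non negative integer n, the integer 120n + 31 is represented by the ternary quadratic form f(x,y,z) = 6x² + 10(2y+z)² + 15z²; moreover, any integer solution (a,b,c) of f(a,b,c) = 120n + 31 satisfies a ≡ 2b+c ≡ c ≡ 1 (mod 2), 2b+c ≢ 0 (mod 3), and a ≡ ±1 (mod 5). -/
/-- The ternary quadratic form with Gram matrix `[[a, t, s], [t, b, r], [s, r, c]]`. -/
def ternaryForm (a b c r s t x y z : ℤ) : ℤ :=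
  a * x ^ 2 + b * y ^ 2 + c * z ^ 2 + 2 * r * (y * z) + 2 * s * (x * z) + 2 * t * (x * y)

/-- The ternary form represents `K`, and its values divisible by `3` occur on a set closed under
addition. -/
def RepresentsAnisotropic (K a b c r s t : ℤ) : Prop :=
  (∃ x y z, ternaryForm a b c r s t x y z = K) ∧
  ∀ x y z x' y' z', 3 ∣ ternaryForm a b c r s t x y z → 3 ∣ ternaryForm a b c r s t x' y' z' →
    3 ∣ ternaryForm a b c r s t (x + x') (y + y') (z + z')

theorem RepresentsAnisotropic.swap {K a b c r s t : ℤ} (h : RepresentsAnisotropic K a b c r s t) :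
    RepresentsAnisotropic K b a c s r t := by
  have key : ∀ x y z, ternaryForm b a c s r t x y z = ternaryForm a b c r s t y x z := by
    intro x y z; unfold ternaryForm; ring
  obtain ⟨⟨x, y, z, hK⟩, hs⟩ := h
  refine ⟨⟨y, x, z, by rw [key, hK]⟩, ?_⟩
  intro x y z x' y' z' h1 h2
  rw [key] at *
  exact hs _ _ _ _ _ _ h1 h2

theorem RepresentsAnisotropic.subst {K a b c r s t : ℤ} (h : RepresentsAnisotropic K a b c r s t)
    (k l p q u v : ℤ) (hdet : p * v - q * u = 1) :
    RepresentsAnisotropic K a (ternaryForm a b c r s t k p u) (ternaryForm a b c r s t l q v)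
      (a * k * l + b * p * q + c * u * v + r * (p * v + q * u) + s * (k * v + l * u)
        + t * (k * q + l * p))
      (a * l + t * q + s * v) (a * k + t * p + s * u) := by
  have key : ∀ x y z, ternaryForm a (ternaryForm a b c r s t k p u) (ternaryForm a b c r s t l q v)
      (a * k * l + b * p * q + c * u * v + r * (p * v + q * u) + s * (k * v + l * u)
        + t * (k * q + l * p))
      (a * l + t * q + s * v) (a * k + t * p + s * u) x y z =
      ternaryForm a b c r s t (x + k * y + l * z) (p * y + q * z) (u * y + v * z) := by
    intro x y z; unfold ternaryForm; ring
  obtain ⟨⟨x, y, z, hK⟩, hs⟩ := h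
  refine ⟨⟨x - k * (v * y - q * z) - l * (p * z - u * y), v * y - q * z, p * z - u * y, ?_⟩, ?_⟩
  · rw [key, ← hK]
    congr 1
    · ring
    · linear_combination y * hdet
    · linear_combination z * hdet
  · intro x y z x' y' z' h1 h2
    rw [key] at *
    have := hs _ _ _ _ _ _ h1 h2
    convert this using 2 <;> ring

theorem exists_shift_two_mul_abs_le (a t : ℤ) (ha : 0 < a) :
    ∃ k : ℤ, 2 * (t + a * k) ≤ a ∧ -a ≤ 2 * (t + a * k) := by
  refine ⟨-((2 * t + a) / (2 * a)), ?_⟩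
  have h1 := Int.emod_add_mul_ediv (2 * t + a) (2 * a)
  have h2 := Int.emod_nonneg (2 * t + a) (show 2 * a ≠ 0 by omega)
  have h3 := Int.emod_lt_of_pos (2 * t + a) (show 0 < 2 * a by omega)
  constructor <;> nlinarith

theorem exists_binary_value_le (n : ℕ) : ∀ B R C D : ℤ, 0 < B → B ≤ n → 0 < D →
    B * C - R ^ 2 = D → ∃ p q u v : ℤ, p * v - q * u = 1 ∧
      3 * (B * p ^ 2 + 2 * R * (p * u) + C * u ^ 2) ^ 2 ≤ 4 * D := by
  induction n with
  | zero => intro B R C D h1 h2; push_cast at h2; omega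
  | succ n ih =>
    intro B R C D hB hn hD hdet
    obtain ⟨k, hk1, hk2⟩ := exists_shift_two_mul_abs_le B R hB
    have hdet' : B * (C + 2 * k * R + k ^ 2 * B) - (R + B * k) ^ 2 = D := by
      linear_combination hdet
    have hC : 0 < C + 2 * k * R + k ^ 2 * B := by
      by_contra hneg
      nlinarith [sq_nonneg (R + B * k)]
    by_cases hlt : C + 2 * k * R + k ^ 2 * B < B
    · obtain ⟨p, q, u, v, h1, h2⟩ := ih _ (-(R + B * k)) B D hC (by push_cast at hn; omega) hD
        (by linear_combination hdet')
      refine ⟨k * p - u, k * q - v, p, q, by linear_combination h1, ?_⟩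
      convert h2 using 3
      ring
    · refine ⟨1, 0, 0, 1, by ring, ?_⟩
      nlinarith [mul_nonneg (sub_nonneg.2 hk1) (by linarith : 0 ≤ B + 2 * (R + B * k)),
        mul_le_mul_of_nonneg_left (not_lt.1 hlt) hB.le]

theorem binary_value_pos {B R C D p q u v : ℤ} (hB : 0 < B) (hD : 0 < D)
    (hdet : B * C - R ^ 2 = D) (hpv : p * v - q * u = 1) :
    0 < B * p ^ 2 + 2 * R * (p * u) + C * u ^ 2 := by
  have e : B * (B * p ^ 2 + 2 * R * (p * u) + C * u ^ 2) = (B * p + R * u) ^ 2 + D * u ^ 2 := by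
    linear_combination u ^ 2 * hdet
  refine pos_of_mul_pos_right (a := B) ?_ hB.le
  rw [e]
  by_cases hu : u = 0
  · have hp : p ≠ 0 := by
      rintro rfl
      simp [hu] at hpv
    have : B * p + R * u ≠ 0 := by
      rw [hu]; simp [hp, hB.ne']
    positivity
  · positivity

theorem represented_of_leading_coeff_one {K b c r s t : ℤ}
    (h : RepresentsAnisotropic K 1 b c r s t) (hB : 0 < b - t ^ 2)
    (hdet : b * c - r ^ 2 + 2 * r * s * t - s ^ 2 * b - t ^ 2 * c = 3) :
    ∃ x y z : ℤ, x ^ 2 + y ^ 2 + 3 * z ^ 2 = K := by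
  obtain ⟨p, q, u, v, hpv, hle⟩ := exists_binary_value_le (b - t ^ 2).toNat (b - t ^ 2) (r - s * t)
    (c - s ^ 2) 3 hB (by omega) (by norm_num) (by linear_combination hdet)
  have h1 := h.subst (-(t * p + s * u)) (-(t * q + s * v)) p q u v hpv
  set B := (b - t ^ 2) * p ^ 2 + 2 * (r - s * t) * (p * u) + (c - s ^ 2) * u ^ 2 with hBdef
  set C := (b - t ^ 2) * q ^ 2 + 2 * (r - s * t) * (q * v) + (c - s ^ 2) * v ^ 2 with hCdef
  set R := (b - t ^ 2) * p * q + (r - s * t) * (p * v + q * u) + (c - s ^ 2) * u * v with hRdef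
  have hBC : B * C - R ^ 2 = 3 := by
    have : B * C - R ^ 2 = ((b - t ^ 2) * (c - s ^ 2) - (r - s * t) ^ 2) * (p * v - q * u) ^ 2 := by
      rw [hBdef, hCdef, hRdef]; ring
    rw [this, hpv]; linear_combination hdet
  have h2 : RepresentsAnisotropic K 1 B C R 0 0 := by
    convert h1 using 1
    · rw [hBdef]; unfold ternaryForm; ring
    · rw [hCdef]; unfold ternaryForm; ring
    · rw [hRdef]; ring
    · ring
    · ring
  have hBpos : 0 < B := binary_value_pos hB (by norm_num : (0 : ℤ) < 3)
    (by linear_combination hdet) hpv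
  have hB2 : B ≤ 2 := by nlinarith
  clear_value B C R
  obtain ⟨k, hk1, hk2⟩ := exists_shift_two_mul_abs_le B R hBpos
  have h3 := h2.subst 0 0 1 k 0 1 (by ring)
  have h4 : RepresentsAnisotropic K 1 B (C + 2 * k * R + k ^ 2 * B) (R + B * k) 0 0 := by
    convert h3 using 1 <;> (try unfold ternaryForm) <;> ring
  have hdet4 : B * (C + 2 * k * R + k ^ 2 * B) - (R + B * k) ^ 2 = 3 := by
    linear_combination hBC
  generalize C + 2 * k * R + k ^ 2 * B = C' at *
  generalize R + B * k = R' at *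
  have hB12 : B = 1 ∨ B = 2 := by omega
  rcases hB12 with rfl | rfl
  · have hR : R' = 0 := by omega
    subst hR
    have hC' : C' = 3 := by linarith
    subst hC'
    obtain ⟨⟨x, y, z, hx⟩, -⟩ := h4
    exact ⟨x, y, z, by rw [← hx]; unfold ternaryForm; ring⟩
  · exfalso
    have hR : R' = -1 ∨ R' = 0 ∨ R' = 1 := by omega
    have hs := h4.2 1 1 0 (-1) 1 0 (by simp [ternaryForm]) (by simp [ternaryForm])
    simp [ternaryForm] at hs

theorem represented_of_det_eq_three (n : ℕ) : ∀ K a b c r s t : ℤ, 0 < a → a ≤ n →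
    0 < a * b - t ^ 2 → a * (b * c - r ^ 2) + 2 * r * s * t - s ^ 2 * b - t ^ 2 * c = 3 →
    RepresentsAnisotropic K a b c r s t → ∃ x y z : ℤ, x ^ 2 + y ^ 2 + 3 * z ^ 2 = K := by
  induction n with
  | zero => intro K a b c r s t h1 h2; push_cast at h2; omega
  | succ n ih =>
    intro K a b c r s t ha hn hB hdet h
    have hD : (a * b - t ^ 2) * (a * c - s ^ 2) - (a * r - s * t) ^ 2 = 3 * a := by
      linear_combination a * hdet
    obtain ⟨p, q, u, v, hpv, hle⟩ := exists_binary_value_le (a * b - t ^ 2).toNat _ _ _ _ hB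
      (by omega) (by omega) hD
    obtain ⟨k, hk1, hk2⟩ := exists_shift_two_mul_abs_le a (t * p + s * u) ha
    have h1 := h.subst k 0 p q u v hpv
    have hBval : a * ternaryForm a b c r s t k p u - (a * k + t * p + s * u) ^ 2 =
        (a * b - t ^ 2) * p ^ 2 + 2 * (a * r - s * t) * (p * u) + (a * c - s ^ 2) * u ^ 2 := by
      unfold ternaryForm; ring
    have hBpos := binary_value_pos hB (by omega : 0 < 3 * a) hD hpv
    rw [← hBval] at hle hBpos
    have hdet' : a * (ternaryForm a b c r s t k p u * ternaryForm a b c r s t 0 q v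
        - (a * k * 0 + b * p * q + c * u * v + r * (p * v + q * u) + s * (k * v + 0 * u)
        + t * (k * q + 0 * p)) ^ 2) + 2 * (a * k * 0 + b * p * q + c * u * v
        + r * (p * v + q * u) + s * (k * v + 0 * u) + t * (k * q + 0 * p))
        * (a * 0 + t * q + s * v) * (a * k + t * p + s * u)
        - (a * 0 + t * q + s * v) ^ 2 * ternaryForm a b c r s t k p u
        - (a * k + t * p + s * u) ^ 2 * ternaryForm a b c r s t 0 q v = 3 := by
      have : ∀ d : ℤ, d = (a * (b * c - r ^ 2) + 2 * r * s * t - s ^ 2 * b - t ^ 2 * c)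
          * (p * v - q * u) ^ 2 → d = 3 := by
        intro d hd; rw [hd, hpv, hdet]; norm_num
      apply this
      unfold ternaryForm; ring
    have ht : a * k + t * p + s * u = t * p + s * u + a * k := by ring
    rw [← ht] at hk1 hk2
    generalize a * k + t * p + s * u = t' at *
    generalize ternaryForm a b c r s t k p u = b' at *
    generalize ternaryForm a b c r s t 0 q v = c' at *
    generalize a * k * 0 + b * p * q + c * u * v + r * (p * v + q * u) + s * (k * v + 0 * u)
        + t * (k * q + 0 * p) = r' at *
    generalize a * 0 + t * q + s * v = s' at *
    have hb' : 0 < b' := by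
      by_contra hneg
      nlinarith [sq_nonneg t']
    by_cases hlt : b' < a
    · exact ih K b' a c' s' r' t' hb' (by push_cast at hn; omega) (by linarith)
        (by linear_combination hdet') h1.swap
    · have ht2 : 4 * t' ^ 2 ≤ a ^ 2 := by nlinarith
      have hab : a * a ≤ a * b' := mul_le_mul_of_nonneg_left (not_lt.1 hlt) ha.le
      have h5 : 3 * a ^ 2 ≤ 4 * (a * b' - t' ^ 2) := by nlinarith
      have h6 : (3 * a ^ 2) ^ 2 ≤ (4 * (a * b' - t' ^ 2)) ^ 2 :=
        pow_le_pow_left₀ (by positivity) h5 2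
      have h7 : a * (9 * a ^ 3) ≤ a * 64 := by nlinarith
      have h8 : 9 * a ^ 3 ≤ 64 := le_of_mul_le_mul_left h7 ha
      have ha1 : a = 1 := by
        by_contra hne
        have : 2 ≤ a := by omega
        have := pow_le_pow_left₀ (by norm_num) this 3
        linarith
      subst ha1
      exact represented_of_leading_coeff_one h1 (by linarith) (by linear_combination hdet')

theorem legendreSym_neg_eq_one {j l p : ℕ} [Fact p.Prime]
    (hp : p = 4 * j + 1 + 4 * (24 * j + 7) * l) :
    legendreSym p (-((1 + 24 * l : ℕ) : ℤ)) = 1 := by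
  have hp4 : p % 4 = 1 := by rw [hp]; ring_nf; omega
  have hb4 : (1 + 24 * l) % 4 = 1 := by omega
  have hbodd : Odd (1 + 24 * l) := by rw [Nat.odd_iff]; omega
  have hb8 : (1 + 24 * l) % 8 = 1 := by omega
  have hpodd : Odd p := by rw [Nat.odd_iff]; omega
  rw [jacobiSym.legendreSym.to_jacobiSym, jacobiSym.neg _ hpodd, ZMod.χ₄_nat_one_mod_four hp4,
    one_mul, jacobiSym.quadratic_reciprocity_one_mod_four hb4 hpodd]
  have h2 : jacobiSym 2 (1 + 24 * l) = 1 := by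
    rw [jacobiSym.at_two hbodd, ZMod.χ₈_nat_eq_if_mod_eight]
    simp [hb8]; omega
  have h3 : jacobiSym 3 (1 + 24 * l) = 1 := by
    have := jacobiSym.quadratic_reciprocity_one_mod_four' (a := 3) (b := 1 + 24 * l)
      (by decide) hb4
    have e : ((3 : ℕ) : ℤ) = 3 := rfl
    rw [e] at this
    rw [this, jacobiSym.mod_left]
    have : (((1 + 24 * l : ℕ) : ℤ) % ((3 : ℕ) : ℤ)) = 1 := by omega
    rw [this, jacobiSym.one_left]
  have h6 : jacobiSym (2 * 3 * p) (1 + 24 * l) = 1 := by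
    have : jacobiSym (2 * 3 * p) (1 + 24 * l) = jacobiSym (-1) (1 + 24 * l) := by
      apply jacobiSym.mod_left'
      apply Int.ModEq.symm
      rw [Int.modEq_iff_dvd]
      refine ⟨24 * j + 7, ?_⟩
      rw [hp]; push_cast; ring
    rw [this, jacobiSym.at_neg_one hbodd, ZMod.χ₄_nat_one_mod_four hb4]
  rw [jacobiSym.mul_left, jacobiSym.mul_left, h2, h3] at h6
  simpa using h6

theorem anisotropic_mod_three : ∀ A h P x y : ZMod 3, A * P - h ^ 2 = 1 →
    A * x ^ 2 + 2 * h * (x * y) + P * y ^ 2 = 0 → x = 0 ∧ y = 0 := by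
  decide

theorem exists_sq_add_three_sq_add_three_sq (j : ℕ) :
    ∃ x y z : ℤ, x ^ 2 + 3 * y ^ 2 + 3 * z ^ 2 = 24 * j + 7 := by
  have hcop : Nat.Coprime (4 * j + 1) (4 * (24 * j + 7)) := by
    apply Nat.Coprime.mul_right
    · have : Nat.Coprime (4 * j + 1) 4 := by simp
      exact this
    · have : 24 * j + 7 = 1 + 6 * (4 * j + 1) := by ring
      rw [this]
      simp
  obtain ⟨p, hpgt, hpp, hpm⟩ := Nat.forall_exists_prime_gt_and_modEq (4 * j + 1)
    (by omega : 4 * (24 * j + 7) ≠ 0) hcop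
  obtain ⟨l, hl⟩ := (Nat.modEq_iff_dvd' hpgt.le).1 hpm.symm
  have hp : p = 4 * j + 1 + 4 * (24 * j + 7) * l := by omega
  have := Fact.mk hpp
  have hp4 : p % 4 = 1 := by rw [hp]; ring_nf; omega
  obtain ⟨h, hodd, hdvd⟩ : ∃ h : ℤ, h % 2 = 1 ∧ (p : ℤ) ∣ h ^ 2 + (1 + 24 * l) := by
    have hleg := legendreSym_neg_eq_one hp
    have hne : ((-((1 + 24 * l : ℕ) : ℤ) : ℤ) : ZMod p) ≠ 0 := by
      intro h0
      rw [(legendreSym.eq_zero_iff p _).2 h0] at hleg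
      exact zero_ne_one hleg
    obtain ⟨w, hw⟩ := (legendreSym.eq_one_iff p hne).1 hleg
    obtain ⟨g, rfl⟩ := ZMod.intCast_surjective w
    have hg : (p : ℤ) ∣ g ^ 2 + (1 + 24 * l) := by
      rw [← ZMod.intCast_zmod_eq_zero_iff_dvd]
      push_cast at hw ⊢
      linear_combination -hw
    rcases Int.emod_two_eq_zero_or_one g with hg2 | hg2
    · refine ⟨g + p, by omega, ?_⟩
      have : (g + p) ^ 2 + (1 + 24 * l : ℤ) = g ^ 2 + (1 + 24 * l) + p * (2 * g + p) := by ring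
      rw [this]
      exact dvd_add hg (dvd_mul_right _ _)
    · exact ⟨g, hg2, hg⟩
  obtain ⟨A, hA⟩ : (2 * p : ℤ) ∣ h ^ 2 + (1 + 24 * l) := by
    have h2 : (2 : ℤ) ∣ h ^ 2 + (1 + 24 * l) := by
      obtain ⟨k, rfl⟩ : ∃ k, h = 2 * k + 1 := ⟨h / 2, by omega⟩
      exact ⟨2 * k ^ 2 + 2 * k + 1 + 12 * l, by ring⟩
    refine IsCoprime.mul_dvd ?_ h2 hdvd
    rw [Int.isCoprime_iff_gcd_eq_one]
    have : Nat.Coprime 2 p := by rw [Nat.coprime_two_left, Nat.odd_iff]; omega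
    exact_mod_cast this
  have hp0 : (0 : ℤ) < p := by exact_mod_cast hpp.pos
  have hApos : 0 < A := by
    refine pos_of_mul_pos_right (a := (2 * p : ℤ)) ?_ (by positivity)
    rw [← hA]; positivity
  have hmod : ∀ x y z : ℤ, 3 ∣ ternaryForm A (2 * p) (3 * (24 * j + 7)) 0 3 h x y z →
      3 ∣ x ∧ 3 ∣ y := by
    intro x y z hd
    have h1 := (ZMod.intCast_zmod_eq_zero_iff_dvd _ 3).2 hd
    have hA' := congrArg (Int.cast : ℤ → ZMod 3) hA
    have h30 : (3 : ZMod 3) = 0 := rfl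
    unfold ternaryForm at h1
    push_cast at h1 hA'
    have := anisotropic_mod_three A h (2 * p) x y
      (by linear_combination -hA' + 8 * (l : ZMod 3) * h30)
      (by linear_combination h1 - ((24 * j + 7) * z ^ 2 + 2 * (x * z)) * h30)
    exact ⟨(ZMod.intCast_zmod_eq_zero_iff_dvd _ 3).1 this.1,
      (ZMod.intCast_zmod_eq_zero_iff_dvd _ 3).1 this.2⟩
  have hrep : RepresentsAnisotropic (3 * (24 * j + 7)) A (2 * p) (3 * (24 * j + 7)) 0 3 h := by
    refine ⟨⟨0, 0, 1, by simp [ternaryForm]⟩, ?_⟩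
    intro x y z x' y' z' h1 h2
    obtain ⟨⟨x, rfl⟩, ⟨y, rfl⟩⟩ := hmod _ _ _ h1
    obtain ⟨⟨x', rfl⟩, ⟨y', rfl⟩⟩ := hmod _ _ _ h2
    refine ⟨3 * A * (x + x') ^ 2 + 6 * p * (y + y') ^ 2 + (24 * j + 7) * (z + z') ^ 2
      + 6 * ((x + x') * (z + z')) + 6 * h * ((x + x') * (y + y')), ?_⟩
    unfold ternaryForm; ring
  have hpZ : (p : ℤ) = 4 * j + 1 + 4 * (24 * j + 7) * l := by exact_mod_cast hp
  obtain ⟨x, y, z, hxyz⟩ := represented_of_det_eq_three A.toNat _ _ _ _ _ _ _ hApos (by omega)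
    (by
      have : A * (2 * p) - h ^ 2 = 1 + 24 * l := by linear_combination -hA
      rw [this]; positivity)
    (by linear_combination (-3 * (24 * j + 7)) * hA - 18 * hpZ) hrep
  have hxy : 3 ∣ x ∧ 3 ∣ y := by
    have h1 := congrArg (Int.cast : ℤ → ZMod 3) hxyz
    have h30 : (3 : ZMod 3) = 0 := rfl
    push_cast at h1
    have := anisotropic_mod_three 1 0 1 x y (by ring)
      (by linear_combination h1 + (24 * j + 7 - z ^ 2) * h30)
    exact ⟨(ZMod.intCast_zmod_eq_zero_iff_dvd _ 3).1 this.1,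
      (ZMod.intCast_zmod_eq_zero_iff_dvd _ 3).1 this.2⟩
  obtain ⟨⟨x, rfl⟩, ⟨y, rfl⟩⟩ := hxy
  exact ⟨z, x, y, by linarith⟩

/-- The integer `m` is represented by `6x² + 10(2y+z)² + 15z²`. -/
def IsRepresented (m : ℤ) : Prop :=
  ∃ a b c : ℤ, 6 * a ^ 2 + 10 * (2 * b + c) ^ 2 + 15 * c ^ 2 = m

/-- A solution of `x² + 3y² + 3z² = m` in odd integers that agree modulo `4`. -/
structure IsBalanced (m X Y Z : ℤ) : Prop where
  odd : X % 2 = 1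
  left : 4 ∣ X - Y
  right : 4 ∣ X - Z
  eq : X ^ 2 + 3 * Y ^ 2 + 3 * Z ^ 2 = m

theorem IsBalanced.swap {m X Y Z : ℤ} (h : IsBalanced m X Y Z) : IsBalanced m X Z Y :=
  ⟨h.odd, h.right, h.left, by linarith [h.eq]⟩

theorem isRepresented_of_sq_add_modEq {m X Y Z : ℤ} (hm : m % 5 = 1)
    (h : X ^ 2 + 3 * Y ^ 2 + 3 * Z ^ 2 = m) (hZ : Z % 2 = 1) (hYZ : (Y + Z) % 4 = 2)
    (h5 : 5 ∣ (Y + Z) ^ 2 - 4) : IsRepresented m := by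
  obtain ⟨b, hb⟩ : ∃ b, Y = Z + 4 * b := ⟨(Y - Z) / 4, by omega⟩
  subst hb
  obtain ⟨k, hk⟩ := h5
  have hd : 5 ∣ (X + b) * (X - b) :=
    ⟨m / 5 + 1 + k - 2 * (Z + 2 * b) ^ 2 - 5 * b ^ 2, by
      have hm5 : m = 5 * (m / 5) + 1 := by omega
      linear_combination h + hm5 + hk⟩
  rcases (Int.prime_iff_natAbs_prime.2 (by norm_num : Nat.Prime (5 : ℤ).natAbs)).dvd_or_dvd hd
    with hd | hd
  · obtain ⟨c, hc⟩ : ∃ c, X = 5 * c + 4 * b := ⟨(X - 4 * b) / 5, by omega⟩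
    subst hc
    exact ⟨Z + 2 * b, b, c, by rw [← h]; ring⟩
  · obtain ⟨c, hc⟩ : ∃ c, X = 5 * c - 4 * b := ⟨(X + 4 * b) / 5, by omega⟩
    subst hc
    exact ⟨Z + 2 * b, -b, c, by rw [← h]; ring⟩

theorem isRepresented_of_exceptional {m : ℤ} (hm : m % 5 = 1) (k : ℕ) : ∀ X Y Z : ℤ,
    IsBalanced m X Y Z → 5 ∣ X - Y → 5 ∣ Z - 3 * X → 5 ∣ X ^ 2 - 1 →
    ¬ ((2 : ℤ) ^ (k + 3) ∣ X + 3 * Z ∧ (2 : ℤ) ^ (k + 3) ∣ X - Y) → IsRepresented m := by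
  have escape : ∀ X Y Z : ℤ, IsBalanced m X Y Z → 5 ∣ X - Y → 5 ∣ Z - 3 * X → 5 ∣ X ^ 2 - 1 →
      ¬ (8 ∣ X + 3 * Z ∧ 8 ∣ X - Y) → IsRepresented m := by
    intro X Y Z hb hXY hXZ hX1 hnot
    obtain ⟨ho, hl, hr, he⟩ := hb
    obtain ⟨e, he1⟩ := hXY
    obtain ⟨g, hg1⟩ := hXZ
    obtain ⟨q, hq⟩ := hX1
    by_cases hs : 8 ∣ X + 3 * Z
    · have ht : ¬ 8 ∣ X - Y := fun ht => hnot ⟨hs, ht⟩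
      obtain ⟨d, hd⟩ : ∃ d, X = Y + 4 * d := ⟨(X - Y) / 4, by omega⟩
      refine isRepresented_of_sq_add_modEq (X := X - 6 * d) (Y := Y + 2 * d) (Z := -Z) hm ?_
        (by omega) (by omega) ?_
      · rw [← he, hd]; ring
      · obtain ⟨i, hi⟩ : ∃ i, Y + 2 * d + -Z = -2 * X + 5 * i :=
          ⟨(Y + 2 * d + -Z + 2 * X) / 5, by omega⟩
        rw [hi]
        exact ⟨4 * q - 4 * X * i + 5 * i ^ 2, by linear_combination 4 * hq⟩
    · obtain ⟨d, hd⟩ : ∃ d, X = 4 * d - 3 * Z := ⟨(X + 3 * Z) / 4, by omega⟩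
      refine isRepresented_of_sq_add_modEq (X := X - 2 * d) (Y := Y) (Z := -(Z - 2 * d)) hm ?_
        (by omega) (by omega) ?_
      · rw [← he, hd]; ring
      · obtain ⟨i, hi⟩ : ∃ i, Y + -(Z - 2 * d) = -2 * X + 5 * i :=
          ⟨(Y + -(Z - 2 * d) + 2 * X) / 5, by omega⟩
        rw [hi]
        exact ⟨4 * q - 4 * X * i + 5 * i ^ 2, by linear_combination 4 * hq⟩
  induction k with
  | zero => simpa using escape
  | succ k ih =>
    intro X Y Z hb hXY hXZ hX1 hnot
    by_cases h8 : 8 ∣ X + 3 * Z ∧ 8 ∣ X - Y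
    swap
    · exact escape X Y Z hb hXY hXZ hX1 h8
    by_cases hk : (2 : ℤ) ^ (k + 3) ∣ X + 3 * Z ∧ (2 : ℤ) ^ (k + 3) ∣ X - Y
    swap
    · exact ih X Y Z hb hXY hXZ hX1 hk
    obtain ⟨ho, hl, hr, he⟩ := hb
    obtain ⟨q, hq⟩ := hX1
    obtain ⟨⟨d, hd⟩, ⟨e, hde⟩⟩ := h8
    have hpow : (2 : ℤ) ^ (k + 1 + 3) = 2 * 2 ^ (k + 3) := by ring
    by_cases hs : (2 : ℤ) ^ (k + 1 + 3) ∣ X + 3 * Z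
    · have ht : ¬ (2 : ℤ) ^ (k + 1 + 3) ∣ X - Y := fun ht => hnot ⟨hs, ht⟩
      refine ih (X - 12 * e) (Y + 4 * e) Z ⟨by omega, by omega, by omega, ?_⟩ (by omega)
        (by omega) ?_ ?_
      · rw [← he]; linear_combination (-24 * e) * hde
      · obtain ⟨i, hi⟩ : ∃ i, 12 * e = 5 * i := ⟨12 * e / 5, by omega⟩
        rw [hi]
        exact ⟨q - 2 * X * i + 5 * i ^ 2, by linear_combination hq⟩
      · rintro ⟨h1, -⟩
        apply ht
        have h2 : (2 : ℤ) ^ (k + 3) ∣ 12 * e := by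
          have := dvd_sub hk.1 h1
          rwa [show X + 3 * Z - (X - 12 * e + 3 * Z) = 12 * e by ring] at this
        have h3 : (2 : ℤ) ^ (k + 3) ∣ 4 * e := by
          have h3' := dvd_sub h2 hk.2
          rwa [hde, show 12 * e - 8 * e = 4 * e by ring] at h3'
        rw [hpow, hde, show 8 * e = 2 * (4 * e) by ring]
        exact mul_dvd_mul_left 2 h3
    · refine ih (X - 4 * d) Y (Z - 4 * d) ⟨by omega, by omega, by omega, ?_⟩ (by omega)
        (by omega) ?_ ?_
      · rw [← he]; linear_combination (-8 * d) * hd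
      · obtain ⟨i, hi⟩ : ∃ i, 4 * d = 5 * i := ⟨4 * d / 5, by omega⟩
        rw [hi]
        exact ⟨q - 2 * X * i + 5 * i ^ 2, by linear_combination hq⟩
      · rintro ⟨-, h1⟩
        apply hs
        have h2 : (2 : ℤ) ^ (k + 3) ∣ 4 * d := by
          have := dvd_sub hk.2 h1
          rwa [show X - Y - (X - 4 * d - Y) = 4 * d by ring] at this
        rw [hpow, hd, show 8 * d = 2 * (4 * d) by ring]
        exact mul_dvd_mul_left 2 h2

theorem IsBalanced.isRepresented_of_exceptional {m X Y Z : ℤ} (hb : IsBalanced m X Y Z)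
    (hm : m % 5 = 1) (hm3 : m % 3 = 1) (hXY : (X : ZMod 5) = Y) (hXZ : (Z : ZMod 5) = 3 * X)
    (hX1 : (X : ZMod 5) ^ 2 = 1) : IsRepresented m := by
  have toDvd : ∀ a : ℤ, (a : ZMod 5) = 0 → 5 ∣ a := fun a h =>
    (ZMod.intCast_zmod_eq_zero_iff_dvd a 5).1 h
  refine _root_.isRepresented_of_exceptional hm ((X + 3 * Z).natAbs + (X - Y).natAbs) X Y Z hb
    (toDvd _ (by push_cast; rw [hXY]; ring)) (toDvd _ (by push_cast; rw [hXZ]; ring))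
    (toDvd _ (by push_cast; rw [hX1]; ring)) ?_
  rintro ⟨h1, h2⟩
  have hlt := Nat.lt_two_pow_self (n := (X + 3 * Z).natAbs + (X - Y).natAbs + 3)
  have h1' : X + 3 * Z = 0 := by
    refine Int.eq_zero_of_dvd_of_natAbs_lt_natAbs h1 ?_
    rw [Int.natAbs_pow]
    exact lt_of_le_of_lt (by omega) hlt
  have h2' : X - Y = 0 := by
    refine Int.eq_zero_of_dvd_of_natAbs_lt_natAbs h2 ?_
    rw [Int.natAbs_pow]
    exact lt_of_le_of_lt (by omega) hlt
  have hX : X = -3 * Z := by linarith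
  have hY : Y = -3 * Z := by linarith
  have he := hb.eq
  rw [hX, hY] at he
  have : m = 3 * (13 * Z ^ 2) := by rw [← he]; ring
  omega

/-- The residues modulo `5` for which a balanced solution directly gives a representation. -/
abbrev DirectResidue (_x y z : ZMod 5) : Prop := (y + z) ^ 2 = 4

/-- Both possible sign choices after the rotation of `x² + 3z²` lead to residues satisfying `P`. -/
abbrev RotatedResidue (P : ZMod 5 → ZMod 5 → ZMod 5 → Prop) (x y z : ZMod 5) : Prop :=
  P (3 * (x - 3 * z)) y (-(3 * (x + z))) ∧ P (-(3 * (x - 3 * z))) y (3 * (x + z))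

/-- Residues that become direct after at most one rotation. -/
abbrev NearResidue (x y z : ZMod 5) : Prop :=
  DirectResidue x y z ∨ RotatedResidue DirectResidue x y z ∨ RotatedResidue DirectResidue x z y

theorem residue_cases : ∀ x y z : ZMod 5, x ^ 2 + 3 * y ^ 2 + 3 * z ^ 2 = 1 →
    NearResidue x y z ∨ RotatedResidue NearResidue x y z ∨ (x = y ∧ z = 3 * x ∧ x ^ 2 = 1) ∨
      (x = z ∧ y = 3 * x ∧ x ^ 2 = 1) := by
  decide

theorem IsBalanced.isRepresented_of_rotated {m X Y Z : ℤ} (hb : IsBalanced m X Y Z)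
    {P : ZMod 5 → ZMod 5 → ZMod 5 → Prop}
    (hP : ∀ X Y Z : ℤ, IsBalanced m X Y Z → P X Y Z → IsRepresented m)
    (h : RotatedResidue P X Y Z) : IsRepresented m := by
  obtain ⟨ho, hl, hr, he⟩ := hb
  obtain ⟨A, hA⟩ : ∃ A, X = 2 * A + 3 * Z := ⟨(X - 3 * Z) / 2, by omega⟩
  have h50 : (5 : ZMod 5) = 0 := rfl
  have hA5 : (A : ZMod 5) = 3 * (X - 3 * Z) := by
    rw [hA]; push_cast; linear_combination -(A : ZMod 5) * h50
  have hB5 : ((A + 2 * Z : ℤ) : ZMod 5) = 3 * (X + Z) := by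
    rw [hA]; push_cast; linear_combination -(A + 2 * Z : ZMod 5) * h50
  by_cases h4 : 4 ∣ A - Y
  · refine hP A Y (-(A + 2 * Z)) ⟨by omega, h4, by omega, ?_⟩ ?_
    · rw [← he, hA]; ring
    · rw [Int.cast_neg, hA5, hB5]; exact h.1
  · refine hP (-A) Y (A + 2 * Z) ⟨by omega, by omega, by omega, ?_⟩ ?_
    · rw [← he, hA]; ring
    · rw [Int.cast_neg, hA5, hB5]; exact h.2

theorem IsBalanced.isRepresented {m X Y Z : ℤ} (hb : IsBalanced m X Y Z) (hm : m % 5 = 1)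
    (hm3 : m % 3 = 1) : IsRepresented m := by
  have direct : ∀ X Y Z : ℤ, IsBalanced m X Y Z → DirectResidue X Y Z → IsRepresented m := by
    intro X Y Z hb h
    refine isRepresented_of_sq_add_modEq hm hb.eq ?_ ?_ ?_
    · have := hb.odd; have := hb.right; omega
    · have := hb.odd; have := hb.right; have := hb.left; omega
    · apply (ZMod.intCast_zmod_eq_zero_iff_dvd _ 5).1
      push_cast
      rw [h]; ring
  have near : ∀ X Y Z : ℤ, IsBalanced m X Y Z → NearResidue X Y Z → IsRepresented m := by
    intro X Y Z hb h
    rcases h with h | h | h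
    · exact direct X Y Z hb h
    · exact hb.isRepresented_of_rotated direct h
    · exact hb.swap.isRepresented_of_rotated direct h
  have h1 : (X : ZMod 5) ^ 2 + 3 * (Y : ZMod 5) ^ 2 + 3 * (Z : ZMod 5) ^ 2 = 1 := by
    have h5 : ((m - 1 : ℤ) : ZMod 5) = 0 :=
      (ZMod.intCast_zmod_eq_zero_iff_dvd (m - 1) 5).2 (by push_cast; omega)
    rw [← hb.eq] at h5
    push_cast at h5
    linear_combination h5
  rcases residue_cases X Y Z h1 with h | h | ⟨h2, h3, h4⟩ | ⟨h2, h3, h4⟩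
  · exact near X Y Z hb h
  · exact hb.isRepresented_of_rotated near h
  · exact hb.isRepresented_of_exceptional hm hm3 h2 h3 h4
  · exact hb.swap.isRepresented_of_exceptional hm hm3 h2 h3 h4

theorem exists_isBalanced_of_odd {m X Y Z : ℤ} (h : X ^ 2 + 3 * Y ^ 2 + 3 * Z ^ 2 = m)
    (hX : X % 2 = 1) (hY : Y % 2 = 1) (hZ : Z % 2 = 1) : ∃ X Y Z, IsBalanced m X Y Z := by
  obtain ⟨Y', hY', hY2⟩ : ∃ Y', 4 ∣ X - Y' ∧ Y' ^ 2 = Y ^ 2 := by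
    by_cases h4 : 4 ∣ X - Y
    · exact ⟨Y, h4, rfl⟩
    · exact ⟨-Y, by omega, by ring⟩
  obtain ⟨Z', hZ', hZ2⟩ : ∃ Z', 4 ∣ X - Z' ∧ Z' ^ 2 = Z ^ 2 := by
    by_cases h4 : 4 ∣ X - Z
    · exact ⟨Z, h4, rfl⟩
    · exact ⟨-Z, by omega, by ring⟩
  exact ⟨X, Y', Z', hX, hY', hZ', by rw [hY2, hZ2, h]⟩

theorem exists_isBalanced {m X Y Z : ℤ} (hm : m % 8 = 7)
    (h : X ^ 2 + 3 * Y ^ 2 + 3 * Z ^ 2 = m) : ∃ X Y Z, IsBalanced m X Y Z := by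
  have even_case : ∀ X Y Z : ℤ, X ^ 2 + 3 * Y ^ 2 + 3 * Z ^ 2 = m → X % 2 = 0 → Y % 2 = 1 →
      Z % 2 = 0 → ∃ X Y Z, IsBalanced m X Y Z := by
    intro X Y Z h hX hY hZ
    obtain ⟨a, rfl⟩ : ∃ a, X = 2 * a := ⟨X / 2, by omega⟩
    obtain ⟨c, rfl⟩ : ∃ c, Z = 2 * c := ⟨Z / 2, by omega⟩
    have hac : (a + c) % 2 = 1 := by
      by_contra hne
      obtain ⟨i, hi⟩ : ∃ i, a = 2 * i - c := ⟨(a + c) / 2, by omega⟩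
      obtain ⟨d, rfl⟩ : ∃ d, Y = 2 * d + 1 := ⟨Y / 2, by omega⟩
      obtain ⟨e, he⟩ : ∃ e, d * (d + 1) = 2 * e := (Int.even_mul_succ_self d).two_dvd
      have : m = 8 * (2 * i ^ 2 - 2 * i * c + 2 * c ^ 2 + 3 * e) + 3 := by
        rw [← h, hi]; linear_combination 12 * he
      omega
    exact exists_isBalanced_of_odd (X := a + 3 * c) (Y := Y) (Z := a - c) (by rw [← h]; ring)
      (by omega) hY (by omega)
  have sq4 : ∀ w : ℤ, (w % 2 = 0 ∧ w ^ 2 % 4 = 0) ∨ (w % 2 = 1 ∧ w ^ 2 % 4 = 1) := by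
    intro w
    rcases Int.emod_two_eq_zero_or_one w with hw | hw
    · refine Or.inl ⟨hw, ?_⟩
      obtain ⟨i, rfl⟩ : ∃ i, w = 2 * i := ⟨w / 2, by omega⟩
      rw [mul_pow]; omega
    · exact Or.inr ⟨hw, Int.sq_mod_four_eq_one_of_odd (Int.odd_iff.2 hw)⟩
  rcases sq4 X with ⟨hX, hX2⟩ | ⟨hX, hX2⟩ <;> rcases sq4 Y with ⟨hY, hY2⟩ | ⟨hY, hY2⟩ <;>
    rcases sq4 Z with ⟨hZ, hZ2⟩ | ⟨hZ, hZ2⟩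
  · omega
  · exact even_case X Z Y (by linarith) hX hZ hY
  · exact even_case X Y Z h hX hY hZ
  · omega
  · omega
  · omega
  · omega
  · exact exists_isBalanced_of_odd h hX hY hZ

theorem isRepresented_of_nonneg {n : ℤ} (hn : 0 ≤ n) : IsRepresented (120 * n + 31) := by
  obtain ⟨X, Y, Z, h⟩ := exists_sq_add_three_sq_add_three_sq (5 * n + 1).toNat
  rw [Int.toNat_of_nonneg (by omega)] at h
  obtain ⟨X', Y', Z', hb⟩ := exists_isBalanced (m := 120 * n + 31) (by omega)
    (h.trans (by ring))
  exact hb.isRepresented (by omega) (by omega)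

theorem congruences_mod_five : ∀ a u c : ZMod 5, 6 * a ^ 2 + 10 * u ^ 2 + 15 * c ^ 2 = 1 →
    a = 1 ∨ a = -1 := by
  decide


/-- For every non negative integer `n`, `120n + 31` is represented by
`f(x,y,z) = 6x² + 10(2y+z)² + 15z²`; moreover any integer solution `(a,b,c)`
of `f(a,b,c) = 120n + 31` satisfies `a ≡ 2b+c ≡ c ≡ 1 (mod 2)`,
`2b+c ≢ 0 (mod 3)` and `a ≡ ±1 (mod 5)`. -/
theorem rep_120n_31_by_f_with_conditions (n : ℤ) (hn : 0 ≤ n) :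
    (∃ a b c : ℤ,
        6 * a ^ 2 + 10 * (2 * b + c) ^ 2 + 15 * c ^ 2 = 120 * n + 31) ∧
    (∀ a b c : ℤ,
        6 * a ^ 2 + 10 * (2 * b + c) ^ 2 + 15 * c ^ 2 = 120 * n + 31 →
          a ≡ 1 [ZMOD 2] ∧ 2 * b + c ≡ 1 [ZMOD 2] ∧ c ≡ 1 [ZMOD 2] ∧
          ¬ (2 * b + c ≡ 0 [ZMOD 3]) ∧
          (a ≡ 1 [ZMOD 5] ∨ a ≡ -1 [ZMOD 5])) := by
  refine ⟨isRepresented_of_nonneg hn, fun a b c h => ?_⟩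
  have hc : c % 2 = 1 := by
    by_contra hne
    obtain ⟨i, rfl⟩ : ∃ i, c = 2 * i := ⟨c / 2, by omega⟩
    have : 2 * (3 * a ^ 2 + 5 * (2 * b + 2 * i) ^ 2 + 30 * i ^ 2) = 120 * n + 31 := by
      rw [← h]; ring
    omega
  have ha : a % 2 = 1 := by
    by_contra hne
    obtain ⟨i, rfl⟩ : ∃ i, a = 2 * i := ⟨a / 2, by omega⟩
    obtain ⟨j, rfl⟩ : ∃ j, c = 2 * j + 1 := ⟨c / 2, by omega⟩
    have : 4 * (6 * i ^ 2 + 10 * (b + j) ^ 2 + 10 * (b + j) + 15 * j ^ 2 + 15 * j) + 25 =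
        120 * n + 31 := by
      rw [← h]; ring
    omega
  refine ⟨ha, ?_, hc, ?_, ?_⟩
  · unfold Int.ModEq; omega
  · intro h3
    obtain ⟨i, hi⟩ := Int.modEq_zero_iff_dvd.1 h3
    rw [hi] at h
    have : 3 * (2 * a ^ 2 + 30 * i ^ 2 + 5 * c ^ 2) = 120 * n + 31 := by rw [← h]; ring
    omega
  · have h5 := congrArg (Int.cast : ℤ → ZMod 5) h
    push_cast at h5
    have h50 : (5 : ZMod 5) = 0 := rfl
    rcases congruences_mod_five a (2 * b + c) c
      (by linear_combination h5 + (24 * n + 6) * h50) with h1 | h1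
    · exact Or.inl ((ZMod.intCast_eq_intCast_iff a 1 5).1 (by simpa using h1))
    · exact Or.inr ((ZMod.intCast_eq_intCast_iff a (-1) 5).1 (by simpa using h1))
end

section
/- Every integer m with m ≡ 20 (mod 21) that is represented by the ternary quadratic form 3x² + 14y² + 42z² is also represented by the ternary quadratic form 5x² + 17y² + 26z² + 2xy + 4xz − 16yz. -/
/-- A vector divisible by `d` on which the form takes the value `d² m` yields a representation
of `m`. -/
lemma represented_of_dvd {d m : ℤ} (hd : d ≠ 0) (a b c : ℤ) (ha : d ∣ a) (hb : d ∣ b) (hc : d ∣ c)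
    (h : 5 * a ^ 2 + 17 * b ^ 2 + 26 * c ^ 2 + 2 * a * b + 4 * a * c - 16 * b * c = d ^ 2 * m) :
    ∃ x y z : ℤ,
      5 * x ^ 2 + 17 * y ^ 2 + 26 * z ^ 2 + 2 * x * y + 4 * x * z - 16 * y * z = m := by
  obtain ⟨x, rfl⟩ := ha
  obtain ⟨y, rfl⟩ := hb
  obtain ⟨z, rfl⟩ := hc
  exact ⟨x, y, z, mul_left_cancel₀ (pow_ne_zero 2 hd) (by linear_combination h)⟩

/-- The vectors `(x, y, z)` with `3 ∤ y` lying outside `3ℤ × ℤ × 3ℤ` are covered by four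
rational isometries with denominator `3`. -/
lemma represented_of_not_dvd_three (x y z : ℤ) (hy : ¬ 3 ∣ y) (hxz : ¬ (3 ∣ x ∧ 3 ∣ z)) :
    ∃ a b c : ℤ,
      5 * a ^ 2 + 17 * b ^ 2 + 26 * c ^ 2 + 2 * a * b + 4 * a * c - 16 * b * c =
        3 * x ^ 2 + 14 * y ^ 2 + 42 * z ^ 2 := by
  have key : 3 ∣ x + y - z ∨ 3 ∣ x - y - z ∨ 3 ∣ x + y + z ∨ 3 ∣ x - y + z := by
    have hx3 : x % 3 = 0 ∨ x % 3 = 1 ∨ x % 3 = 2 := by omega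
    have hy3 : y % 3 = 0 ∨ y % 3 = 1 ∨ y % 3 = 2 := by omega
    have hz3 : z % 3 = 0 ∨ z % 3 = 1 ∨ z % 3 = 2 := by omega
    rcases hx3 with hx3 | hx3 | hx3 <;> rcases hy3 with hy3 | hy3 | hy3 <;>
      rcases hz3 with hz3 | hz3 | hz3 <;> omega
  rcases key with h | h | h | h
  · exact represented_of_dvd (d := 3) (by norm_num) (-x - y - 8 * z) (3 * y) (x + y - z)
      (by omega) (by omega) (by omega) (by ring)
  · exact represented_of_dvd (d := 3) (by norm_num) (-x + y - 8 * z) (-3 * y) (x - y - z)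
      (by omega) (by omega) (by omega) (by ring)
  · exact represented_of_dvd (d := 3) (by norm_num) (-x - y + 8 * z) (3 * y) (x + y + z)
      (by omega) (by omega) (by omega) (by ring)
  · exact represented_of_dvd (d := 3) (by norm_num) (-x + y + 8 * z) (-3 * y) (x - y + z)
      (by omega) (by omega) (by omega) (by ring)

/-- The vectors `(x, y, z)` in `3ℤ × ℤ × 3ℤ` with `x ≡ 3 (mod 7)` are covered by seven
rational isometries with denominator `21`. -/
lemma represented_of_dvd_three (x y z : ℤ) (hx : 3 ∣ x) (hz : 3 ∣ z) (hx7 : 7 ∣ x - 3) :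
    ∃ a b c : ℤ,
      5 * a ^ 2 + 17 * b ^ 2 + 26 * c ^ 2 + 2 * a * b + 4 * a * c - 16 * b * c =
        3 * x ^ 2 + 14 * y ^ 2 + 42 * z ^ 2 := by
  have key : (z - 4 * y) % 7 = 0 ∨ (z - 4 * y) % 7 = 3 ∨ (z - 4 * y) % 7 = 6 ∨
      (z - 4 * y) % 7 = 2 ∨ (z - 4 * y) % 7 = 5 ∨ (z - 4 * y) % 7 = 1 ∨
      (z - 4 * y) % 7 = 4 := by omega
  rcases key with h | h | h | h | h | h | h
  · exact represented_of_dvd (d := 21) (by norm_num)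
      (-7 * x - 33 * y - 4 * z) (3 * y + 36 * z) (7 * x - 3 * y + 13 * z)
      (by omega) (by omega) (by omega) (by ring)
  · exact represented_of_dvd (d := 21) (by norm_num)
      (-3 * x - 33 * y + 24 * z) (-8 * x + 3 * y - 20 * z) (x - 3 * y - 29 * z)
      (by omega) (by omega) (by omega) (by ring)
  · exact represented_of_dvd (d := 21) (by norm_num)
      (-15 * x - 9 * y - 24 * z) (6 * x - 9 * y - 24 * z) (3 * x - 15 * y + 9 * z)
      (by omega) (by omega) (by omega) (by ring)
  · exact represented_of_dvd (d := 21) (by norm_num)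
      (-15 * x + 15 * y + 12 * z) (2 * x - 9 * y + 32 * z) (5 * x + 9 * y + 17 * z)
      (by omega) (by omega) (by omega) (by ring)
  · exact represented_of_dvd (d := 21) (by norm_num)
      (-15 * x - 15 * y - 12 * z) (2 * x + 9 * y - 32 * z) (5 * x - 9 * y - 17 * z)
      (by omega) (by omega) (by omega) (by ring)
  · exact represented_of_dvd (d := 21) (by norm_num)
      (-15 * x + 9 * y + 24 * z) (6 * x + 9 * y + 24 * z) (3 * x + 15 * y - 9 * z)
      (by omega) (by omega) (by omega) (by ring)
  · exact represented_of_dvd (d := 21) (by norm_num)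
      (-3 * x + 33 * y - 24 * z) (-8 * x - 3 * y + 20 * z) (x + 3 * y + 29 * z)
      (by omega) (by omega) (by omega) (by ring)

/-- Every integer `m ≡ 20 (mod 21)` represented by `3x² + 14y² + 42z²` is
also represented by `5x² + 17y² + 26z² + 2xy + 4xz − 16yz`. -/
theorem rep_transfer_21_20 (m : ℤ) (hm : m ≡ 20 [ZMOD 21])
    (h : ∃ x y z : ℤ, 3 * x ^ 2 + 14 * y ^ 2 + 42 * z ^ 2 = m) :
    ∃ x y z : ℤ,
      5 * x ^ 2 + 17 * y ^ 2 + 26 * z ^ 2 + 2 * x * y + 4 * x * z - 16 * y * z = m := by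
  obtain ⟨x, y, z, rfl⟩ := h
  have hm3 : (3 * x ^ 2 + 14 * y ^ 2 + 42 * z ^ 2) % 21 = 20 := hm
  have hy : ¬ 3 ∣ y := by
    rintro ⟨k, rfl⟩
    ring_nf at hm3
    omega
  have hx7 : 7 ∣ x - 3 ∨ 7 ∣ x + 3 := by
    have h7 : (7 : ℤ) ∣ (x - 3) * (x + 3) := by
      ring_nf
      omega
    exact (Int.prime_ofNat_iff.mpr (by norm_num)).dvd_or_dvd h7
  by_cases hxz : 3 ∣ x ∧ 3 ∣ z
  · obtain ⟨hx, hz⟩ := hxz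
    rcases hx7 with hx7 | hx7
    · exact represented_of_dvd_three x y z hx hz hx7
    · simpa using represented_of_dvd_three (-x) y z (by omega) hz (by omega)
  · exact represented_of_not_dvd_three x y z hy hxz
end

section
/- For every non negative integer n, the equation 6x² + 14y² + 21z² = 168n + 41 has an integer solution (a,b,c); moreover, any such solution satisfies a ≡ b ≡ c ≡ 1 (mod 2), b ≢ 0 (mod 3), and a ≡ ±1 (mod 7). -/
namespace UnimodularTernary

/-- Centred division with remainder. -/
theorem exists_abs_two_mul_le {a : ℤ} (ha : 0 < a) (b : ℤ) : ∃ k : ℤ, |2 * (b + k * a)| ≤ a := by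
  have h₁ := Int.emod_add_mul_ediv (2 * b + a) (2 * a)
  have h₂ := Int.emod_nonneg (2 * b + a) (by lia : 2 * a ≠ 0)
  have h₃ := Int.emod_lt_of_pos (2 * b + a) (by lia : 0 < 2 * a)
  refine ⟨-((2 * b + a) / (2 * a)), abs_le.2 ⟨?_, ?_⟩⟩ <;> nlinarith

theorem binary_pos {A B C p r : ℤ} (hA : 0 < A) (h : 0 < A * C - B ^ 2) (hpr : p ≠ 0 ∨ r ≠ 0) :
    0 < A * p ^ 2 + 2 * B * p * r + C * r ^ 2 := by
  have key : A * (A * p ^ 2 + 2 * B * p * r + C * r ^ 2) =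
      (A * p + B * r) ^ 2 + (A * C - B ^ 2) * r ^ 2 := by ring
  refine pos_of_mul_pos_right (a := A) ?_ hA.le
  rw [key]
  rcases eq_or_ne r 0 with rfl | hr
  · have hp : p ≠ 0 := by simpa using hpr
    have := mul_ne_zero hA.ne' hp
    simp only [mul_zero, add_zero]
    positivity
  · positivity

/-- A positive definite binary form properly represents a number that is small compared to its
determinant. -/
theorem exists_binary_small (A B C : ℤ) (hA : 0 < A) (h : 0 < A * C - B ^ 2) :
    ∃ p q r s : ℤ, p * s - q * r = 1 ∧
      3 * (A * p ^ 2 + 2 * B * p * r + C * r ^ 2) ^ 2 ≤ 4 * (A * C - B ^ 2) := by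
  induction hn : A.toNat using Nat.strong_induction_on generalizing A B C with
  | _ n ih =>
  obtain ⟨k, hk⟩ := exists_abs_two_mul_le hA B
  set B' := B + k * A with hB'
  set C' := C + 2 * k * B + k ^ 2 * A with hC'
  have hdet : A * C' - B' ^ 2 = A * C - B ^ 2 := by rw [hB', hC']; ring
  have hC : 0 < C' := by nlinarith [sq_nonneg B']
  rcases lt_or_ge C' A with hlt | hge
  · obtain ⟨p, q, r, s, h₁, h₂⟩ := ih C'.toNat (by lia) C' (-B') A hC (by linarith) rfl
    refine ⟨k * p - r, k * q - s, p, q, by linear_combination h₁, ?_⟩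
    have : A * (k * p - r) ^ 2 + 2 * B * (k * p - r) * p + C * p ^ 2 =
        C' * p ^ 2 + 2 * (-B') * p * r + A * r ^ 2 := by rw [hB', hC']; ring
    rw [this]
    linarith
  · refine ⟨1, 0, 0, 1, by ring, ?_⟩
    have h₁ : (2 * B') ^ 2 ≤ A ^ 2 := sq_le_sq' (by linarith [(abs_le.1 hk).1]) (abs_le.1 hk).2
    nlinarith

theorem lt_or_eq_of_small {a b f : ℤ} (hpos : 0 < a * b - f ^ 2)
    (hs : 3 * (a * b - f ^ 2) ^ 2 ≤ 4 * a) (hf : -a ≤ 2 * f ∧ 2 * f ≤ a) :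
    b < a ∨ a = 1 ∧ b = 1 ∧ f = 0 := by
  rcases eq_or_ne a 1 with rfl | ha1
  · obtain rfl : f = 0 := by lia
    have : b < 2 := by
      by_contra! hb2
      nlinarith
    lia
  · left
    have ha : 0 < a := by
      by_contra!
      nlinarith
    by_contra! hle
    have hf' : (2 * f) ^ 2 ≤ a ^ 2 := sq_le_sq' hf.1 hf.2
    have h₀ := mul_le_mul_of_nonneg_left hle ha.le
    have h₁ : 3 * a ^ 2 ≤ 4 * (a * b - f ^ 2) := by linarith
    have h₂ : (3 * a ^ 2) ^ 2 ≤ (4 * (a * b - f ^ 2)) ^ 2 :=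
      pow_le_pow_left₀ (by positivity) h₁ 2
    have h₃ : a * (27 * a ^ 3) ≤ a * 64 := by linarith
    have h₄ := le_of_mul_le_mul_left h₃ ha
    have h₅ := pow_le_pow_left₀ (by decide : (0 : ℤ) ≤ 2) (show 2 ≤ a by lia) 3
    linarith

/-- The ternary form with Gram matrix `!![a, f, e; f, b, d; e, d, c]`. -/
def form (a b c d e f x y z : ℤ) : ℤ :=
  a * x ^ 2 + b * y ^ 2 + c * z ^ 2 + 2 * d * y * z + 2 * e * x * z + 2 * f * x * y

/-- Every positive definite integral ternary form of determinant one takes only values that are sums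
of three squares. -/
theorem exists_three_sq_eq_form (a b c d e f : ℤ) (ha : 0 < a) (hab : 0 < a * b - f ^ 2)
    (hdet : a * b * c + 2 * d * e * f - a * d ^ 2 - b * e ^ 2 - c * f ^ 2 = 1) (x y z : ℤ) :
    ∃ t u v : ℤ, form a b c d e f x y z = t ^ 2 + u ^ 2 + v ^ 2 := by
  induction hn : a.toNat using Nat.strong_induction_on generalizing a b c d e f x y z with
  | _ n ih =>
  have hD : (a * b - f ^ 2) * (a * c - e ^ 2) - (a * d - e * f) ^ 2 = a := by
    linear_combination a * hdet
  obtain ⟨p, q, r, s, hpq, hsmall⟩ :=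
    exists_binary_small (a * b - f ^ 2) (a * d - e * f) (a * c - e ^ 2) hab (by rwa [hD])
  have hpos := binary_pos (p := p) (r := r) hab (by rwa [hD]) (by
    by_contra! hc
    rw [hc.1, hc.2] at hpq
    simp at hpq)
  rw [hD] at hsmall
  obtain ⟨k, hk⟩ := exists_abs_two_mul_le ha (f * p + e * r)
  obtain ⟨b', hb'⟩ : ∃ b', b' = form a b c d e f k p r := ⟨_, rfl⟩
  obtain ⟨c', hc'⟩ : ∃ c', c' = form a b c d e f 0 q s := ⟨_, rfl⟩
  obtain ⟨d', hd'⟩ : ∃ d', d' = k * (f * q + e * s) + p * (b * q + d * s) + r * (d * q + c * s) :=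
    ⟨_, rfl⟩
  obtain ⟨e', he'⟩ : ∃ e', e' = f * q + e * s := ⟨_, rfl⟩
  obtain ⟨f', hf'⟩ : ∃ f', f' = f * p + e * r + k * a := ⟨_, rfl⟩
  have hmin : (a * b - f ^ 2) * p ^ 2 + 2 * (a * d - e * f) * p * r + (a * c - e ^ 2) * r ^ 2 =
      a * b' - f' ^ 2 := by
    rw [hb', hf', form]; ring
  have hdet' : a * b' * c' + 2 * d' * e' * f' - a * d' ^ 2 - b' * e' ^ 2 - c' * f' ^ 2 = 1 := by
    have : a * b' * c' + 2 * d' * e' * f' - a * d' ^ 2 - b' * e' ^ 2 - c' * f' ^ 2 =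
        (p * s - q * r) ^ 2 *
          (a * b * c + 2 * d * e * f - a * d ^ 2 - b * e ^ 2 - c * f ^ 2) := by
      rw [hb', hc', hd', he', hf', form, form]; ring
    rw [this, hpq, hdet]; rfl
  obtain ⟨Y, hY⟩ : ∃ Y, Y = s * y - q * z := ⟨_, rfl⟩
  obtain ⟨Z, hZ⟩ : ∃ Z, Z = p * z - r * y := ⟨_, rfl⟩
  have hform : form a b c d e f x y z = form a b' c' d' e' f' (x - k * Y) Y Z := by
    have h₁ : y = p * Y + q * Z := by rw [hY, hZ]; linear_combination (-y) * hpq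
    have h₂ : z = r * Y + s * Z := by rw [hY, hZ]; linear_combination (-z) * hpq
    rw [h₁, h₂, hb', hc', hd', he', hf', form, form, form, form]; ring
  rw [hmin] at hsmall hpos
  rw [← hf', abs_le] at hk
  have hb'0 : 0 < b' := by
    refine pos_of_mul_pos_right (a := a) ?_ ha.le
    linarith [sq_nonneg f']
  rcases lt_or_eq_of_small hpos hsmall hk with hlt | ⟨ha1, hb1, hf0⟩
  · obtain ⟨t, u, v, htuv⟩ := ih b'.toNat (by lia) b' a c' e' d' f' hb'0 (by linarith)
      (by linarith) Y (x - k * Y) Z rfl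
    refine ⟨t, u, v, ?_⟩
    rw [hform, ← htuv, form, form]
    ring
  · rw [ha1, hb1, hf0] at hdet'
    refine ⟨x - k * Y + e' * Z, Y + d' * Z, Z, ?_⟩
    rw [hform, ha1, hb1, hf0, form]
    linear_combination Z ^ 2 * hdet'

theorem exists_sq_add_dvd {p d : ℕ} [Fact p.Prime] (hp : p % 4 = 1) (hd : d % 8 = 3)
    (hpd : d ∣ 2 * p + 1) : ∃ B : ℤ, ((2 * p : ℕ) : ℤ) ∣ B ^ 2 + d := by
  have hd2 : Odd d := Nat.odd_iff.2 (by lia)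
  have hp2 : Odd p := Nat.odd_iff.2 (by lia)
  have h₁ : jacobiSym (-2) d = 1 := by
    rw [jacobiSym.at_neg_two hd2, ZMod.χ₈'_nat_eq_if_mod_eight]
    simp [hd, show d % 2 = 1 by lia]
  have h₂ : jacobiSym (-2 * p) d = 1 := by
    have : jacobiSym (-2 * p) d = jacobiSym 1 d := by
      apply jacobiSym.mod_left'
      refine Int.ModEq.symm ((Int.modEq_iff_dvd).2 ?_)
      have := Int.natCast_dvd_natCast.2 hpd
      push_cast at this
      rw [show -2 * (p : ℤ) - 1 = -(2 * p + 1) by ring]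
      exact this.neg_right
    rw [this, jacobiSym.one_left]
  have h₃ : jacobiSym p d = 1 := by rwa [jacobiSym.mul_left, h₁, one_mul] at h₂
  have h₄ : legendreSym p (-d) = 1 := by
    rw [jacobiSym.legendreSym.to_jacobiSym, ← neg_one_mul, jacobiSym.mul_left,
      jacobiSym.at_neg_one hp2, ZMod.χ₄_nat_one_mod_four hp, one_mul,
      ← jacobiSym.quadratic_reciprocity_one_mod_four hp hd2, h₃]
  obtain ⟨x, hx⟩ := (legendreSym.eq_one_iff p (a := -d) (by
    intro h0
    rw [(legendreSym.eq_zero_iff p _).2 h0] at h₄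
    exact zero_ne_one h₄)).1 h₄
  obtain ⟨y, hy⟩ : ∃ y : ℤ, (p : ℤ) ∣ y ^ 2 + d := by
    refine ⟨x.val, (ZMod.intCast_zmod_eq_zero_iff_dvd _ p).1 ?_⟩
    push_cast at hx ⊢
    rw [ZMod.natCast_zmod_val, sq, ← hx]
    ring
  obtain ⟨B, hB, hB2⟩ : ∃ B : ℤ, (p : ℤ) ∣ B ^ 2 + d ∧ Odd B := by
    rcases Int.even_or_odd y with hy2 | hy2
    · refine ⟨y + p, ?_, hy2.add_odd (by exact_mod_cast hp2)⟩
      rw [show (y + p) ^ 2 + d = y ^ 2 + d + p * (2 * y + p) by ring]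
      exact dvd_add hy (dvd_mul_right _ _)
    · exact ⟨y, hy, hy2⟩
  refine ⟨B, ?_⟩
  push_cast
  refine IsCoprime.mul_dvd ?_ ?_ hB
  · exact_mod_cast hp2.coprime_two_left
  · exact (hB2.pow.add_odd (by exact_mod_cast hd2)).two_dvd

/-- The three-square theorem for integers congruent to 1 modulo 8. -/
theorem exists_three_sq_of_mod_eight_eq_one {n : ℕ} (hn : n % 8 = 1) :
    ∃ a b c : ℤ, (n : ℤ) = a ^ 2 + b ^ 2 + c ^ 2 := by
  obtain ⟨k, rfl⟩ : ∃ k, n = 8 * k + 1 := ⟨n / 8, by lia⟩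
  have hcop : Nat.Coprime (12 * k + 1) (4 * (8 * k + 1)) := by
    rw [Nat.coprime_mul_iff_right]
    constructor
    · rw [show 12 * k + 1 = 1 + 4 * (3 * k) by ring]
      simp
    · refine Nat.isCoprime_iff_coprime.1 ⟨-2, 3, ?_⟩
      push_cast
      ring
  have : NeZero (4 * (8 * k + 1)) := ⟨by lia⟩
  obtain ⟨p, hlt, hp, hpmod⟩ := Nat.forall_exists_prime_gt_and_eq_mod
    ((ZMod.isUnit_iff_coprime _ _).2 hcop) (12 * k + 1)
  obtain ⟨v, rfl⟩ : ∃ v, p = 12 * k + 1 + 4 * (8 * k + 1) * v := by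
    obtain ⟨v, hv⟩ := (Nat.modEq_iff_dvd' hlt.le).1
      ((ZMod.natCast_eq_natCast_iff _ _ _).1 hpmod.symm)
    exact ⟨v, by lia⟩
  have := Fact.mk hp
  have hpd : 2 * (12 * k + 1 + 4 * (8 * k + 1) * v) + 1 = (8 * v + 3) * (8 * k + 1) := by ring
  obtain ⟨B, A, hBA⟩ := exists_sq_add_dvd (d := 8 * v + 3) (by
    rw [show 12 * k + 1 + 4 * (8 * k + 1) * v = 1 + 4 * (3 * k + (8 * k + 1) * v) by ring]
    simp) (by lia) ⟨_, hpd⟩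
  set m : ℤ := ((2 * (12 * k + 1 + 4 * (8 * k + 1) * v) : ℕ) : ℤ) with hm
  have hm' : m = (8 * v + 3) * (8 * k + 1) - 1 := by rw [hm]; push_cast; ring
  have hm0 : 0 < m := by rw [hm]; positivity
  push_cast at hBA
  have hA : 0 < A := by
    refine pos_of_mul_pos_right (a := m) ?_ hm0.le
    rw [← hBA]
    positivity
  obtain ⟨a, b, c, h⟩ := exists_three_sq_eq_form A m (8 * k + 1) 0 1 B hA
    (by rw [mul_comm A, ← hBA]; ring_nf; positivity)
    (by linear_combination -(8 * k + 1 : ℤ) * hBA - hm') 0 0 1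
  refine ⟨a, b, c, ?_⟩
  rw [← h, form]
  push_cast
  ring

end UnimodularTernary

namespace TernaryWalk

/-- The standard bilinear form on integer triples. -/
def dot (v w : ℤ × ℤ × ℤ) : ℤ := v.1 * w.1 + v.2.1 * w.2.1 + v.2.2 * w.2.2

/-- Representatives of the four isotropic lines of `x² + y² + z²` modulo 3. -/
def line3 : Fin 4 → ℤ × ℤ × ℤ := ![(1, 1, 1), (1, 1, -1), (1, -1, 1), (1, -1, -1)]

/-- Representatives of the eight isotropic lines of `x² + y² + z²` modulo 7. -/
def line7 : Fin 8 → ℤ × ℤ × ℤ :=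
  ![(1, 2, -3), (1, -3, -2), (1, 3, 2), (1, -2, 3), (1, 3, -2), (1, -2, -3), (1, 2, 3), (1, -3, 2)]

/-- The imaginary parts of the quaternions of norm 7 with real part 2, up to sign. -/
def quat7 : Fin 8 → ℤ × ℤ × ℤ :=
  ![(1, 1, 1), (1, 1, -1), (1, -1, 1), (1, -1, -1), (-1, 1, 1), (-1, 1, -1), (-1, -1, 1),
    (-1, -1, -1)]

/-- The rotation by `π` about `line3 i`; it is integral on vectors orthogonal to that line mod 3. -/
def turn3 (i : Fin 4) (w : ℤ × ℤ × ℤ) : ℤ × ℤ × ℤ :=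
  (2 * (dot (line3 i) w / 3) * (line3 i).1 - w.1,
    2 * (dot (line3 i) w / 3) * (line3 i).2.1 - w.2.1,
    2 * (dot (line3 i) w / 3) * (line3 i).2.2 - w.2.2)

/-- Conjugation by the `j`-th quaternion of norm 7; it is integral on vectors orthogonal to
`line7 j` mod 7. -/
def turn7 (j : Fin 8) (w : ℤ × ℤ × ℤ) : ℤ × ℤ × ℤ :=
  (dot (3, 2 * ((quat7 j).1 * (quat7 j).2.1 + 2 * (quat7 j).2.2),
      2 * ((quat7 j).1 * (quat7 j).2.2 - 2 * (quat7 j).2.1)) w / 7,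
    dot (2 * ((quat7 j).1 * (quat7 j).2.1 - 2 * (quat7 j).2.2), 3,
      2 * ((quat7 j).2.1 * (quat7 j).2.2 + 2 * (quat7 j).1)) w / 7,
    dot (2 * ((quat7 j).1 * (quat7 j).2.2 + 2 * (quat7 j).2.1),
      2 * ((quat7 j).2.1 * (quat7 j).2.2 - 2 * (quat7 j).1), 3) w / 7)

/-- The image of `line7 j` under `turn3 i`. -/
def move7 : Fin 4 → Fin 8 → Fin 8 :=
  ![![0, 5, 3, 2, 6, 1, 4, 7], ![2, 1, 0, 7, 5, 4, 6, 3], ![4, 3, 2, 1, 0, 5, 7, 6],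
    ![1, 0, 6, 3, 4, 7, 2, 5]]

/-- The image of `line3 i` under `turn7 j`. -/
def move3 : Fin 8 → Fin 4 → Fin 4 :=
  ![![0, 3, 1, 2], ![3, 1, 0, 2], ![1, 3, 2, 0], ![1, 2, 0, 3], ![2, 0, 1, 3], ![3, 0, 2, 1],
    ![2, 1, 3, 0], ![0, 2, 3, 1]]

/-- The line modulo 3 which together with `line7 j` cuts out a copy of `6x² + 14y² + 21z²`. -/
def partner : Fin 8 → Fin 4 := ![2, 0, 3, 1, 2, 0, 3, 1]

/-- `w` is orthogonal to `line3 i` modulo 3. -/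
def Perp3 (w : ℤ × ℤ × ℤ) (i : Fin 4) : Prop := 3 ∣ dot (line3 i) w

/-- `w` is orthogonal to `line7 j` modulo 7. -/
def Perp7 (w : ℤ × ℤ × ℤ) (j : Fin 8) : Prop := 7 ∣ dot (line7 j) w

instance (w : ℤ × ℤ × ℤ) (i : Fin 4) : Decidable (Perp3 w i) :=
  inferInstanceAs (Decidable (3 ∣ dot (line3 i) w))

instance (w : ℤ × ℤ × ℤ) (j : Fin 8) : Decidable (Perp7 w j) :=
  inferInstanceAs (Decidable (7 ∣ dot (line7 j) w))

/-- Consecutive turns of `w` about the lines of a list are all admissible. -/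
def Chain : ℤ × ℤ × ℤ → List (Fin 4) → Prop
  | _, [] => True
  | w, i :: l => Perp3 w i ∧ Chain (turn3 i w) l

instance decidableChain : (w : ℤ × ℤ × ℤ) → (l : List (Fin 4)) → Decidable (Chain w l)
  | _, [] => inferInstanceAs (Decidable True)
  | w, i :: l =>
    haveI := decidableChain (turn3 i w) l
    inferInstanceAs (Decidable (Perp3 w i ∧ Chain (turn3 i w) l))

/-- The image of a chain under the turn with index `j`. -/
def shift : Fin 8 → List (Fin 4) → List (Fin 4)
  | _, [] => []
  | j, i :: l => move3 j i :: shift (move7 i j) l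

/-- No partner pair occurs along a chain that is followed with the line `j` modulo 7. -/
def Avoids : Fin 8 → List (Fin 4) → Bool
  | _, [] => true
  | j, i :: l => i != partner j && Avoids (move7 i j) l

/-- Directions, up to sign, whose orbits meet no partner pair. -/
def stuck : List (ℤ × ℤ × ℤ) :=
  [(1, 2, 0), (1, 4, 0), (3, 2, 2), (0, 1, 5), (4, 3, 1), (3, 10, 4), (5, 8, 6), (11, 2, 0)].flatMap
    fun u ↦ [(u.1, u.2.1, u.2.2), (u.1, -u.2.1, u.2.2), (u.1, u.2.1, -u.2.2),
      (u.1, -u.2.1, -u.2.2), (u.1, u.2.2, u.2.1), (u.1, -u.2.2, u.2.1), (u.1, u.2.2, -u.2.1),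
      (u.1, -u.2.2, -u.2.1)]

/-- No partner pair occurs along a chain that is followed with any of four lines modulo 7, the
lines `c₂` and `d₂` being taken one turn further along `c₁` and `d₁`. -/
def Clear (c₁ c₂ d₁ d₂ : Fin 8) (l : List (Fin 4)) : Bool :=
  Avoids c₁ l && Avoids d₁ l && Avoids c₂ (shift c₁ l) && Avoids d₂ (shift d₁ l)

set_option synthInstance.maxHeartbeats 200000 in
set_option synthInstance.maxSize 1000 in
theorem exists_stuck_of_clear :
    ∀ c₁ d₁ : Fin 8, c₁ ≠ d₁ → ∀ c₂, c₂ ≠ c₁.rev → ∀ d₂, d₂ ≠ d₁.rev →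
    ∀ a₁, Clear c₁ c₂ d₁ d₂ [a₁] → ∀ b₁, b₁ ≠ a₁ → Clear c₁ c₂ d₁ d₂ [b₁] →
    ∀ a₂, a₂ ≠ a₁ → Clear c₁ c₂ d₁ d₂ [a₁, a₂] →
    ∀ b₂, b₂ ≠ b₁ → Clear c₁ c₂ d₁ d₂ [b₁, b₂] →
    ∀ a₃, a₃ ≠ a₂ → Clear c₁ c₂ d₁ d₂ [a₁, a₂, a₃] →
    ∀ b₃, b₃ ≠ b₂ → Clear c₁ c₂ d₁ d₂ [b₁, b₂, b₃] →
    ∃ u ∈ stuck, Chain u [a₁, a₂, a₃] ∧ Chain u [b₁, b₂, b₃] ∧ Perp7 u c₁ ∧ Perp7 u d₁ := by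
  decide +kernel

theorem turn3_turn3 {w : ℤ × ℤ × ℤ} {i : Fin 4} (h : Perp3 w i) : turn3 i (turn3 i w) = w := by
  obtain ⟨x, y, z⟩ := w
  fin_cases i <;> simp [Perp3, turn3, line3, dot] at h ⊢ <;> omega

theorem perp3_turn3 {w : ℤ × ℤ × ℤ} {i : Fin 4} (h : Perp3 w i) : Perp3 (turn3 i w) i := by
  obtain ⟨x, y, z⟩ := w
  fin_cases i <;> simp [Perp3, turn3, line3, dot] at h ⊢ <;> omega

theorem dot_turn3 {w v : ℤ × ℤ × ℤ} {i : Fin 4} (h : Perp3 w i) (h' : Perp3 v i) :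
    dot (turn3 i w) (turn3 i v) = dot w v := by
  obtain ⟨k, hk⟩ := h
  obtain ⟨l, hl⟩ := h'
  simp only [turn3, hk, hl, Int.mul_ediv_cancel_left _ (by decide : (3 : ℤ) ≠ 0)]
  obtain ⟨x, y, z⟩ := w
  obtain ⟨a, b, c⟩ := v
  fin_cases i <;> simp [line3, dot] at hk hl ⊢ <;> linear_combination (-2 * l) * hk - 2 * k * hl

theorem perp7_turn3 {w : ℤ × ℤ × ℤ} {i : Fin 4} {j : Fin 8} (h : Perp3 w i) (h' : Perp7 w j) :
    Perp7 (turn3 i w) (move7 i j) := by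
  obtain ⟨x, y, z⟩ := w
  fin_cases i <;> fin_cases j <;>
    simp [Perp3, Perp7, turn3, line3, line7, move7, dot] at h h' ⊢ <;> omega

theorem perp3_turn7 {w : ℤ × ℤ × ℤ} {i : Fin 4} {j : Fin 8} (h : Perp3 w i) (h' : Perp7 w j) :
    Perp3 (turn7 j w) (move3 j i) := by
  obtain ⟨x, y, z⟩ := w
  fin_cases i <;> fin_cases j <;>
    simp [Perp3, Perp7, turn7, line3, line7, quat7, move3, dot] at h h' ⊢ <;> omega

theorem seven_mul_turn7 {w : ℤ × ℤ × ℤ} {j : Fin 8} (h : Perp7 w j) :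
    7 * (turn7 j w).1 = dot (3, 2 * ((quat7 j).1 * (quat7 j).2.1 + 2 * (quat7 j).2.2),
        2 * ((quat7 j).1 * (quat7 j).2.2 - 2 * (quat7 j).2.1)) w ∧
      7 * (turn7 j w).2.1 = dot (2 * ((quat7 j).1 * (quat7 j).2.1 - 2 * (quat7 j).2.2), 3,
        2 * ((quat7 j).2.1 * (quat7 j).2.2 + 2 * (quat7 j).1)) w ∧
      7 * (turn7 j w).2.2 = dot (2 * ((quat7 j).1 * (quat7 j).2.2 + 2 * (quat7 j).2.1),
        2 * ((quat7 j).2.1 * (quat7 j).2.2 - 2 * (quat7 j).1), 3) w := by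
  obtain ⟨x, y, z⟩ := w
  fin_cases j <;> simp [Perp7, turn7, line7, quat7, dot] at h ⊢ <;> omega

/-- Three times `turn3`, as an integral linear map. -/
def turn3Mul (i : Fin 4) (w : ℤ × ℤ × ℤ) : ℤ × ℤ × ℤ :=
  (2 * dot (line3 i) w * (line3 i).1 - 3 * w.1, 2 * dot (line3 i) w * (line3 i).2.1 - 3 * w.2.1,
    2 * dot (line3 i) w * (line3 i).2.2 - 3 * w.2.2)

/-- Seven times `turn7`, as an integral linear map. -/
def turn7Mul (j : Fin 8) (w : ℤ × ℤ × ℤ) : ℤ × ℤ × ℤ :=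
  (dot (3, 2 * ((quat7 j).1 * (quat7 j).2.1 + 2 * (quat7 j).2.2),
      2 * ((quat7 j).1 * (quat7 j).2.2 - 2 * (quat7 j).2.1)) w,
    dot (2 * ((quat7 j).1 * (quat7 j).2.1 - 2 * (quat7 j).2.2), 3,
      2 * ((quat7 j).2.1 * (quat7 j).2.2 + 2 * (quat7 j).1)) w,
    dot (2 * ((quat7 j).1 * (quat7 j).2.2 + 2 * (quat7 j).2.1),
      2 * ((quat7 j).2.1 * (quat7 j).2.2 - 2 * (quat7 j).1), 3) w)

theorem smul_turn3 {w : ℤ × ℤ × ℤ} {i : Fin 4} (h : Perp3 w i) :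
    (3 : ℤ) • turn3 i w = turn3Mul i w := by
  obtain ⟨k, hk⟩ := h
  simp only [turn3, turn3Mul, hk, Int.mul_ediv_cancel_left _ (by decide : (3 : ℤ) ≠ 0)]
  ext <;> simp <;> ring

theorem smul_turn7 {w : ℤ × ℤ × ℤ} {j : Fin 8} (h : Perp7 w j) :
    (7 : ℤ) • turn7 j w = turn7Mul j w := by
  obtain ⟨h₁, h₂, h₃⟩ := seven_mul_turn7 h
  exact Prod.ext h₁ (Prod.ext h₂ h₃)

theorem turn3Mul_eq (i : Fin 4) (w : ℤ × ℤ × ℤ) : turn3Mul i w = w.1 • turn3Mul i (1, 0, 0) +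
    w.2.1 • turn3Mul i (0, 1, 0) + w.2.2 • turn3Mul i (0, 0, 1) := by
  ext <;> simp [turn3Mul, dot] <;> ring

theorem turn7Mul_eq (j : Fin 8) (w : ℤ × ℤ × ℤ) : turn7Mul j w = w.1 • turn7Mul j (1, 0, 0) +
    w.2.1 • turn7Mul j (0, 1, 0) + w.2.2 • turn7Mul j (0, 0, 1) := by
  ext <;> simp [turn7Mul, dot] <;> ring

theorem turn3Mul_smul (i : Fin 4) (k : ℤ) (w : ℤ × ℤ × ℤ) :
    turn3Mul i (k • w) = k • turn3Mul i w := by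
  ext <;> simp [turn3Mul, dot] <;> ring

theorem turn7Mul_smul (j : Fin 8) (k : ℤ) (w : ℤ × ℤ × ℤ) :
    turn7Mul j (k • w) = k • turn7Mul j w := by
  ext <;> simp [turn7Mul, dot] <;> ring

theorem turn3Mul_add (i : Fin 4) (v w : ℤ × ℤ × ℤ) :
    turn3Mul i (v + w) = turn3Mul i v + turn3Mul i w := by
  ext <;> simp [turn3Mul, dot] <;> ring

theorem turn7Mul_add (j : Fin 8) (v w : ℤ × ℤ × ℤ) :
    turn7Mul j (v + w) = turn7Mul j v + turn7Mul j w := by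
  ext <;> simp [turn7Mul, dot] <;> ring

theorem turn3Mul_turn7Mul (i : Fin 4) (j : Fin 8) (w : ℤ × ℤ × ℤ) :
    turn3Mul (move3 j i) (turn7Mul j w) = turn7Mul (move7 i j) (turn3Mul i w) := by
  have key : ∀ i j, ∀ v ∈ [(1, 0, 0), (0, 1, 0), (0, 0, 1)],
      turn3Mul (move3 j i) (turn7Mul j v) = turn7Mul (move7 i j) (turn3Mul i v) := by
    decide +kernel
  rw [turn7Mul_eq j w, turn3Mul_eq i w]
  simp only [turn3Mul_add, turn7Mul_add, turn3Mul_smul, turn7Mul_smul]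
  rw [key i j _ (by simp), key i j _ (by simp), key i j _ (by simp)]

theorem turn3_turn7 {w : ℤ × ℤ × ℤ} {i : Fin 4} {j : Fin 8} (h : Perp3 w i) (h' : Perp7 w j) :
    turn3 (move3 j i) (turn7 j w) = turn7 (move7 i j) (turn3 i w) := by
  have key : (21 : ℤ) • turn3 (move3 j i) (turn7 j w) = (21 : ℤ) • turn7 (move7 i j) (turn3 i w) :=
    calc (21 : ℤ) • turn3 (move3 j i) (turn7 j w)
        = (7 : ℤ) • (3 : ℤ) • turn3 (move3 j i) (turn7 j w) := by rw [smul_smul]; rfl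
      _ = turn3Mul (move3 j i) (turn7Mul j w) := by
        rw [smul_turn3 (perp3_turn7 h h'), ← turn3Mul_smul, smul_turn7 h']
      _ = (3 : ℤ) • (7 : ℤ) • turn7 (move7 i j) (turn3 i w) := by
        rw [turn3Mul_turn7Mul, smul_turn7 (perp7_turn3 h h'), ← turn7Mul_smul, smul_turn3 h]
      _ = (21 : ℤ) • turn7 (move7 i j) (turn3 i w) := by rw [smul_smul]; rfl
  exact smul_right_injective _ (by decide : (21 : ℤ) ≠ 0) key

theorem dot_turn7 {w : ℤ × ℤ × ℤ} {j : Fin 8} (h : Perp7 w j) :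
    dot (turn7 j w) (turn7 j w) = dot w w := by
  obtain ⟨h₁, h₂, h₃⟩ := seven_mul_turn7 h
  have key : 49 * dot (turn7 j w) (turn7 j w) = 49 * dot w w := by
    have : 49 * dot (turn7 j w) (turn7 j w) = (7 * (turn7 j w).1) ^ 2
        + (7 * (turn7 j w).2.1) ^ 2 + (7 * (turn7 j w).2.2) ^ 2 := by
      simp only [dot]; ring
    rw [this, h₁, h₂, h₃]
    fin_cases j <;> simp [quat7, dot] <;> ring
  omega

/-- The vectors whose first coordinate is odd and whose other coordinates are even. -/
def OddEvenEven (w : ℤ × ℤ × ℤ) : Prop := w.1 % 2 = 1 ∧ w.2.1 % 2 = 0 ∧ w.2.2 % 2 = 0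

theorem OddEvenEven.turn3 {w : ℤ × ℤ × ℤ} {i : Fin 4} (hw : OddEvenEven w) (h : Perp3 w i) :
    OddEvenEven (turn3 i w) := by
  obtain ⟨x, y, z⟩ := w
  fin_cases i <;> simp [OddEvenEven, Perp3, TernaryWalk.turn3, line3, dot] at h hw ⊢ <;> omega

theorem OddEvenEven.turn7 {w : ℤ × ℤ × ℤ} {j : Fin 8} (hw : OddEvenEven w) (h : Perp7 w j) :
    OddEvenEven (turn7 j w) := by
  obtain ⟨x, y, z⟩ := w
  fin_cases j <;>
    simp [OddEvenEven, Perp7, TernaryWalk.turn7, line7, quat7, dot] at h hw ⊢ <;> omega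

/-- Pairwise orthogonal vectors of norms 6, 14 and 21 that are orthogonal to `line3 (partner j)`
modulo 3 and to `line7 j` modulo 7. -/
def orthoBasis : Fin 8 → (ℤ × ℤ × ℤ) × (ℤ × ℤ × ℤ) × (ℤ × ℤ × ℤ) :=
  ![((2, 1, -1), (2, -3, 1), (-1, -2, -4)), ((2, -1, -1), (2, 1, 3), (-1, -4, 2)),
    ((2, 1, 1), (2, -1, -3), (-1, 4, -2)), ((2, -1, 1), (2, 3, -1), (-1, 2, 4)),
    ((2, 1, -1), (2, -1, 3), (-1, 4, 2)), ((2, -1, -1), (2, 3, 1), (-1, 2, -4)),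
    ((2, 1, 1), (2, -3, -1), (-1, -2, 4)), ((2, -1, 1), (2, 1, -3), (-1, -4, -2))]

theorem exists_repr_of_partner {w : ℤ × ℤ × ℤ} {j : Fin 8} (hw : OddEvenEven w)
    (h : Perp3 w (partner j)) (h' : Perp7 w j) :
    ∃ a b c : ℤ, 6 * a ^ 2 + 14 * b ^ 2 + 21 * c ^ 2 = dot w w := by
  obtain ⟨x, y, z⟩ := w
  have H : 6 ∣ dot (orthoBasis j).1 (x, y, z) ∧ 14 ∣ dot (orthoBasis j).2.1 (x, y, z) ∧
      21 ∣ dot (orthoBasis j).2.2 (x, y, z) := by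
    fin_cases j <;>
      simp [OddEvenEven, Perp3, Perp7, partner, line3, line7, orthoBasis, dot] at hw h h' ⊢ <;>
      omega
  obtain ⟨⟨a, ha⟩, ⟨b, hb⟩, ⟨c, hc⟩⟩ := H
  refine ⟨a, b, c, ?_⟩
  have key : 42 * (6 * a ^ 2 + 14 * b ^ 2 + 21 * c ^ 2) =
      7 * (6 * a) ^ 2 + 3 * (14 * b) ^ 2 + 2 * (21 * c) ^ 2 := by ring
  have : 42 * (6 * a ^ 2 + 14 * b ^ 2 + 21 * c ^ 2) = 42 * dot (x, y, z) (x, y, z) := by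
    rw [key, ← ha, ← hb, ← hc]
    fin_cases j <;> simp [orthoBasis, dot] <;> ring
  omega

theorem exists_perp3 {w : ℤ × ℤ × ℤ} (h : dot w w % 3 = 2) :
    ∃ a b, b ≠ a ∧ ∀ i, Perp3 w i ↔ i = a ∨ i = b := by
  have key : ∀ x y z : ZMod 3, x * x + y * y + z * z = 2 → ∃ a b : Fin 4, b ≠ a ∧ ∀ i,
      ((line3 i).1 : ZMod 3) * x + (line3 i).2.1 * y + (line3 i).2.2 * z = 0 ↔ i = a ∨ i = b := by
    decide +kernel
  obtain ⟨a, b, hab, H⟩ := key w.1 w.2.1 w.2.2 (by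
    have : ((dot w w : ℤ) : ZMod 3) = (2 : ℤ) := (ZMod.intCast_eq_intCast_iff' _ _ 3).2 h
    simpa [dot] using this)
  refine ⟨a, b, hab, fun i ↦ ?_⟩
  rw [← H, Perp3, ← Nat.cast_ofNat (n := 3), ← ZMod.intCast_zmod_eq_zero_iff_dvd]
  simp [dot]

theorem exists_perp7 {w : ℤ × ℤ × ℤ} (h : dot w w % 7 ∈ ({3, 5, 6} : Finset ℤ)) :
    ∃ c d, c ≠ d ∧ ∀ j, Perp7 w j ↔ j = c ∨ j = d := by
  have key : ∀ x y z : ZMod 7, x * x + y * y + z * z ∈ ({3, 5, 6} : Finset (ZMod 7)) →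
      ∃ c d : Fin 8, c ≠ d ∧ ∀ j,
      ((line7 j).1 : ZMod 7) * x + (line7 j).2.1 * y + (line7 j).2.2 * z = 0 ↔ j = c ∨ j = d := by
    decide +kernel
  obtain ⟨c, d, hcd, H⟩ := key w.1 w.2.1 w.2.2 (by
    have : ((dot w w : ℤ) : ZMod 7) = ((dot w w % 7 : ℤ) : ZMod 7) :=
      (ZMod.intCast_mod _ 7).symm
    simp only [dot, Int.cast_add, Int.cast_mul] at this
    rw [this]
    simp only [dot, Finset.mem_insert, Finset.mem_singleton] at h
    rcases h with h | h | h <;> rw [h] <;> decide)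
  refine ⟨c, d, hcd, fun j ↦ ?_⟩
  rw [← H, Perp7, ← Nat.cast_ofNat (n := 7), ← ZMod.intCast_zmod_eq_zero_iff_dvd]
  simp [dot]

/-- `w` and `u` admit the same turns modulo 3 for the first `n + 1` steps. -/
def SameTurns : ℕ → ℤ × ℤ × ℤ → ℤ × ℤ × ℤ → Prop
  | 0, w, u => ∀ i, Perp3 w i ↔ Perp3 u i
  | n + 1, w, u => (∀ i, Perp3 w i ↔ Perp3 u i) ∧
      ∀ i, Perp3 w i → SameTurns n (turn3 i w) (turn3 i u)

instance decidableSameTurns : (n : ℕ) → (w u : ℤ × ℤ × ℤ) → Decidable (SameTurns n w u)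
  | 0, w, u => inferInstanceAs (Decidable (∀ i, Perp3 w i ↔ Perp3 u i))
  | n + 1, w, u =>
    haveI := fun i ↦ decidableSameTurns n (turn3 i w) (turn3 i u)
    inferInstanceAs (Decidable ((∀ i, Perp3 w i ↔ Perp3 u i) ∧
      ∀ i, Perp3 w i → SameTurns n (turn3 i w) (turn3 i u)))

theorem stuck_eq_or_eq_neg : ∀ u ∈ stuck, ∀ v ∈ stuck, ∀ i, Perp3 u i →
    SameTurns 1 (turn3 i u) v → (∀ j, Perp7 (turn3 i u) j ↔ Perp7 v j) →
    v = turn3 i u ∨ v = -turn3 i u := by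
  decide +kernel

theorem dot_stuck : ∀ u ∈ stuck, dot u u % 3 = 2 ∧ dot u u % 7 ∈ ({3, 5, 6} : Finset ℤ) := by
  decide +kernel

/-- Integer points with odd first and even remaining coordinates on the sphere of norm `m`. -/
def Vertex (m : ℤ) (w : ℤ × ℤ × ℤ) : Prop := OddEvenEven w ∧ dot w w = m

theorem Vertex.turn3 {m : ℤ} {w : ℤ × ℤ × ℤ} {i : Fin 4} (hw : Vertex m w) (h : Perp3 w i) :
    Vertex m (turn3 i w) :=
  ⟨hw.1.turn3 h, (dot_turn3 h h).trans hw.2⟩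

theorem Vertex.turn7 {m : ℤ} {w : ℤ × ℤ × ℤ} {j : Fin 8} (hw : Vertex m w) (h : Perp7 w j) :
    Vertex m (turn7 j w) :=
  ⟨hw.1.turn7 h, (dot_turn7 h).trans hw.2⟩

theorem Chain.turn7 {w : ℤ × ℤ × ℤ} {j : Fin 8} {l : List (Fin 4)} (hl : Chain w l)
    (h : Perp7 w j) : Chain (turn7 j w) (shift j l) := by
  induction l generalizing w j with
  | nil => trivial
  | cons i l ih =>
    refine ⟨perp3_turn7 hl.1 h, ?_⟩
    rw [turn3_turn7 hl.1 h]
    exact ih hl.2 (perp7_turn3 hl.1 h)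

theorem Chain.avoids {m : ℤ} (hm : ∀ a b c : ℤ, 6 * a ^ 2 + 14 * b ^ 2 + 21 * c ^ 2 ≠ m)
    {w : ℤ × ℤ × ℤ} {j : Fin 8} {l : List (Fin 4)} (hw : Vertex m w) (hl : Chain w l)
    (h : Perp7 w j) : Avoids j l := by
  induction l generalizing w j with
  | nil => rfl
  | cons i l ih =>
    simp only [Avoids, Bool.and_eq_true, bne_iff_ne]
    refine ⟨?_, ih (hw.turn3 hl.1) hl.2 (perp7_turn3 hl.1 h)⟩
    rintro rfl
    obtain ⟨a, b, c, habc⟩ := exists_repr_of_partner hw.1 hl.1 h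
    exact hm a b c (habc.trans hw.2)

theorem exists_perp3_ne {w : ℤ × ℤ × ℤ} (h : dot w w % 3 = 2) (i : Fin 4) :
    ∃ a, a ≠ i ∧ Perp3 w a := by
  obtain ⟨a, b, hab, H⟩ := exists_perp3 h
  rcases eq_or_ne a i with rfl | ha
  · exact ⟨b, hab, (H b).2 (.inr rfl)⟩
  · exact ⟨a, ha, (H a).2 (.inl rfl)⟩

theorem exists_perp7_ne {w : ℤ × ℤ × ℤ} (h : dot w w % 7 ∈ ({3, 5, 6} : Finset ℤ)) (j : Fin 8) :
    ∃ c, c ≠ j ∧ Perp7 w c := by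
  obtain ⟨c, d, hcd, H⟩ := exists_perp7 h
  rcases eq_or_ne c j with rfl | hc
  · exact ⟨d, hcd.symm, (H d).2 (.inr rfl)⟩
  · exact ⟨c, hc, (H c).2 (.inl rfl)⟩

theorem perp3_iff_of_ne {w : ℤ × ℤ × ℤ} (h : dot w w % 3 = 2) {a b : Fin 4} (hab : b ≠ a)
    (ha : Perp3 w a) (hb : Perp3 w b) (i : Fin 4) : Perp3 w i ↔ i = a ∨ i = b := by
  obtain ⟨p, q, hpq, H⟩ := exists_perp3 h
  rw [H] at ha hb ⊢
  grind

theorem perp7_iff_of_ne {w : ℤ × ℤ × ℤ} (h : dot w w % 7 ∈ ({3, 5, 6} : Finset ℤ)) {c d : Fin 8}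
    (hcd : c ≠ d) (hc : Perp7 w c) (hd : Perp7 w d) (j : Fin 8) :
    Perp7 w j ↔ j = c ∨ j = d := by
  obtain ⟨p, q, hpq, H⟩ := exists_perp7 h
  rw [H] at hc hd ⊢
  grind

theorem sameTurns_zero {w u : ℤ × ℤ × ℤ} (hw : dot w w % 3 = 2) (hu : dot u u % 3 = 2)
    {a b : Fin 4} (hab : b ≠ a) (ha : Perp3 w a) (hb : Perp3 w b) (ha' : Perp3 u a)
    (hb' : Perp3 u b) : SameTurns 0 w u := fun i ↦ by
  rw [perp3_iff_of_ne hw hab ha hb, perp3_iff_of_ne hu hab ha' hb']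

theorem Chain.sameTurns {w u : ℤ × ℤ × ℤ} (hw : dot w w % 3 = 2) (hu : dot u u % 3 = 2)
    (h₀ : SameTurns 0 w u) {a₁ a₂ a₃ : Fin 4} (h₂ : a₂ ≠ a₁) (h₃ : a₃ ≠ a₂)
    (hl : Chain w [a₁, a₂, a₃]) (hl' : Chain u [a₁, a₂, a₃]) :
    SameTurns 1 (turn3 a₁ w) (turn3 a₁ u) := by
  obtain ⟨p₁, p₂, p₃, -⟩ := hl
  obtain ⟨q₁, q₂, q₃, -⟩ := hl'
  have hw₁ : dot (turn3 a₁ w) (turn3 a₁ w) % 3 = 2 := by rwa [dot_turn3 p₁ p₁]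
  have hu₁ : dot (turn3 a₁ u) (turn3 a₁ u) % 3 = 2 := by rwa [dot_turn3 q₁ q₁]
  have hw₂ : dot (turn3 a₂ (turn3 a₁ w)) (turn3 a₂ (turn3 a₁ w)) % 3 = 2 := by
    rwa [dot_turn3 p₂ p₂]
  have hu₂ : dot (turn3 a₂ (turn3 a₁ u)) (turn3 a₂ (turn3 a₁ u)) % 3 = 2 := by
    rwa [dot_turn3 q₂ q₂]
  refine ⟨sameTurns_zero hw₁ hu₁ h₂ (perp3_turn3 p₁) p₂ (perp3_turn3 q₁) q₂, fun i hi ↦ ?_⟩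
  rcases (perp3_iff_of_ne hw₁ h₂ (perp3_turn3 p₁) p₂ i).1 hi with rfl | rfl
  · rwa [turn3_turn3 p₁, turn3_turn3 q₁]
  · exact sameTurns_zero hw₂ hu₂ h₃ (perp3_turn3 p₂) p₃ (perp3_turn3 q₂) q₃

theorem SameTurns.symm : ∀ {n : ℕ} {w u : ℤ × ℤ × ℤ}, SameTurns n w u → SameTurns n u w
  | 0, _, _, h => fun i ↦ (h i).symm
  | _ + 1, _, _, h => ⟨fun i ↦ (h.1 i).symm, fun i hi ↦ (h.2 i ((h.1 i).2 hi)).symm⟩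

theorem SameTurns.trans : ∀ {n : ℕ} {w u v : ℤ × ℤ × ℤ}, SameTurns n w u → SameTurns n u v →
    SameTurns n w v
  | 0, _, _, _, h, h' => fun i ↦ (h i).trans (h' i)
  | _ + 1, _, _, _, h, h' => ⟨fun i ↦ (h.1 i).trans (h'.1 i), fun i hi ↦
      (h.2 i hi).trans (h'.2 i ((h.1 i).1 hi))⟩

theorem SameTurns.of_succ : ∀ {n : ℕ} {w u : ℤ × ℤ × ℤ}, SameTurns (n + 1) w u → SameTurns n w u
  | 0, _, _, h => h.1
  | _ + 1, _, _, h => ⟨h.1, fun i hi ↦ (h.2 i hi).of_succ⟩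

theorem exists_stuck {m : ℤ} (h3 : m % 3 = 2) (h7 : m % 7 ∈ ({3, 5, 6} : Finset ℤ))
    (hm : ∀ a b c : ℤ, 6 * a ^ 2 + 14 * b ^ 2 + 21 * c ^ 2 ≠ m) {w : ℤ × ℤ × ℤ}
    (hw : Vertex m w) :
    ∃ u ∈ stuck, SameTurns 2 w u ∧ ∀ j, Perp7 w j ↔ Perp7 u j := by
  have H3 : ∀ {v}, Vertex m v → dot v v % 3 = 2 := fun hv ↦ by rwa [hv.2]
  have H7 : ∀ {v}, Vertex m v → dot v v % 7 ∈ ({3, 5, 6} : Finset ℤ) := fun hv ↦ by rwa [hv.2]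
  obtain ⟨a₁, b₁, h₁, H₁⟩ := exists_perp3 (H3 hw)
  have ha₁ := (H₁ a₁).2 (.inl rfl)
  have hb₁ := (H₁ b₁).2 (.inr rfl)
  obtain ⟨a₂, h₂, ha₂⟩ := exists_perp3_ne (H3 (hw.turn3 ha₁)) a₁
  obtain ⟨b₂, h₂', hb₂⟩ := exists_perp3_ne (H3 (hw.turn3 hb₁)) b₁
  obtain ⟨a₃, h₃, ha₃⟩ := exists_perp3_ne (H3 ((hw.turn3 ha₁).turn3 ha₂)) a₂
  obtain ⟨b₃, h₃', hb₃⟩ := exists_perp3_ne (H3 ((hw.turn3 hb₁).turn3 hb₂)) b₂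
  obtain ⟨c₁, d₁, hcd, H₂⟩ := exists_perp7 (H7 hw)
  have hc₁ := (H₂ c₁).2 (.inl rfl)
  have hd₁ := (H₂ d₁).2 (.inr rfl)
  obtain ⟨c₂, hc, hc₂⟩ := exists_perp7_ne (H7 (hw.turn7 hc₁)) c₁.rev
  obtain ⟨d₂, hd, hd₂⟩ := exists_perp7_ne (H7 (hw.turn7 hd₁)) d₁.rev
  have clear : ∀ {l}, Chain w l → Clear c₁ c₂ d₁ d₂ l := fun {l} hl ↦ by
    simp only [Clear, Bool.and_eq_true]
    exact ⟨⟨⟨hl.avoids hm hw hc₁, hl.avoids hm hw hd₁⟩,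
      (hl.turn7 hc₁).avoids hm (hw.turn7 hc₁) hc₂⟩, (hl.turn7 hd₁).avoids hm (hw.turn7 hd₁) hd₂⟩
  obtain ⟨u, hu, hua, hub, huc, hud⟩ := exists_stuck_of_clear c₁ d₁ hcd c₂ hc d₂ hd
    a₁ (clear ⟨ha₁, trivial⟩) b₁ h₁ (clear ⟨hb₁, trivial⟩)
    a₂ h₂ (clear ⟨ha₁, ha₂, trivial⟩) b₂ h₂' (clear ⟨hb₁, hb₂, trivial⟩)
    a₃ h₃ (clear ⟨ha₁, ha₂, ha₃, trivial⟩) b₃ h₃' (clear ⟨hb₁, hb₂, hb₃, trivial⟩)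
  have h₀ := sameTurns_zero (H3 hw) (dot_stuck u hu).1 h₁ ha₁ hb₁ hua.1 hub.1
  refine ⟨u, hu, ⟨h₀, fun i hi ↦ ?_⟩, fun j ↦ ?_⟩
  · rcases (H₁ i).1 hi with rfl | rfl
    · exact Chain.sameTurns (H3 hw) (dot_stuck u hu).1 h₀ h₂ h₃ ⟨ha₁, ha₂, ha₃, trivial⟩ hua
    · exact Chain.sameTurns (H3 hw) (dot_stuck u hu).1 h₀ h₂' h₃' ⟨hb₁, hb₂, hb₃, trivial⟩ hub
  · rw [H₂, perp7_iff_of_ne (dot_stuck u hu).2 hcd huc hud]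

theorem perp7_turn3_iff {w : ℤ × ℤ × ℤ} {i : Fin 4} (h : Perp3 w i) (j : Fin 8) :
    Perp7 (turn3 i w) j ↔ Perp7 w (move7 i j) := by
  have inv : ∀ i j, move7 i (move7 i j) = j := by decide
  constructor
  · intro h'
    simpa only [turn3_turn3 h] using perp7_turn3 (perp3_turn3 h) h'
  · intro h'
    simpa only [inv] using perp7_turn3 h h'

/-- The vector product of integer triples. -/
def cross (v w : ℤ × ℤ × ℤ) : ℤ × ℤ × ℤ :=
  (v.2.1 * w.2.2 - v.2.2 * w.2.1, v.2.2 * w.1 - v.1 * w.2.2, v.1 * w.2.1 - v.2.1 * w.1)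

theorem turn3Mul_cross {w u : ℤ × ℤ × ℤ} {i : Fin 4} (h : Perp3 w i) (h' : Perp3 u i) :
    turn3Mul i (cross (turn3 i w) (turn3 i u)) = (3 : ℤ) • cross w u := by
  obtain ⟨k, hk⟩ := h
  obtain ⟨l, hl⟩ := h'
  obtain ⟨x, y, z⟩ := w
  obtain ⟨a, b, c⟩ := u
  simp only [turn3, hk, hl, Int.mul_ediv_cancel_left _ (by decide : (3 : ℤ) ≠ 0)]
  ext <;> fin_cases i <;> simp [turn3Mul, cross, line3, dot] at hk hl ⊢ <;> grind

theorem three_dvd_of_turn3Mul_eq {a b : Fin 4} (hab : b ≠ a) {E E' : ℤ × ℤ × ℤ}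
    (h : turn3Mul a E = turn3Mul b E') : 3 ∣ dot (line3 a) E := by
  obtain ⟨x, y, z⟩ := E
  obtain ⟨x', y', z'⟩ := E'
  fin_cases a <;> fin_cases b <;> simp [turn3Mul, line3, dot] at hab h ⊢ <;> omega

theorem three_dvd_of_dot_eq_zero {a b : Fin 4} (hab : b ≠ a) {F u : ℤ × ℤ × ℤ}
    (hu : dot u u % 3 = 2) (ha : Perp3 u a) (hb : Perp3 u b) (hFa : Perp3 F a) (hFb : Perp3 F b)
    (h : dot F u = 0) : ∃ G : ℤ × ℤ × ℤ, F = (3 : ℤ) • G := by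
  have key : ∀ a b : Fin 4, b ≠ a → ∀ u₁ u₂ u₃ : ZMod 3, u₁ * u₁ + u₂ * u₂ + u₃ * u₃ = 2 →
      ((line3 a).1 : ZMod 3) * u₁ + (line3 a).2.1 * u₂ + (line3 a).2.2 * u₃ = 0 →
      ((line3 b).1 : ZMod 3) * u₁ + (line3 b).2.1 * u₂ + (line3 b).2.2 * u₃ = 0 →
      ∀ x y z : ZMod 3, ((line3 a).1 : ZMod 3) * x + (line3 a).2.1 * y + (line3 a).2.2 * z = 0 →
      ((line3 b).1 : ZMod 3) * x + (line3 b).2.1 * y + (line3 b).2.2 * z = 0 →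
      x * u₁ + y * u₂ + z * u₃ = 0 → x = 0 ∧ y = 0 ∧ z = 0 := by
    decide +kernel
  have cast : ∀ {i : Fin 4} {v : ℤ × ℤ × ℤ}, Perp3 v i → ((line3 i).1 : ZMod 3) * (v.1 : ℤ)
      + (line3 i).2.1 * (v.2.1 : ℤ) + (line3 i).2.2 * (v.2.2 : ℤ) = 0 := fun {i v} hv ↦ by
    have := (ZMod.intCast_zmod_eq_zero_iff_dvd (dot (line3 i) v) 3).2 hv
    simpa [dot] using this
  have h₂ : ((dot u u : ℤ) : ZMod 3) = (2 : ℤ) := (ZMod.intCast_eq_intCast_iff' _ _ 3).2 hu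
  have h₀ : ((dot F u : ℤ) : ZMod 3) = (0 : ℤ) := by rw [h]
  obtain ⟨h₁, h₂, h₃⟩ := key a b hab u.1 u.2.1 u.2.2 (by simpa [dot] using h₂) (cast ha) (cast hb)
    F.1 F.2.1 F.2.2 (cast hFa) (cast hFb) (by simpa [dot] using h₀)
  obtain ⟨x, hx⟩ := (ZMod.intCast_zmod_eq_zero_iff_dvd _ 3).1 h₁
  obtain ⟨y, hy⟩ := (ZMod.intCast_zmod_eq_zero_iff_dvd _ 3).1 h₂
  obtain ⟨z, hz⟩ := (ZMod.intCast_zmod_eq_zero_iff_dvd _ 3).1 h₃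
  exact ⟨(x, y, z), Prod.ext hx (Prod.ext hy hz)⟩

theorem exists_cross_eq_pow_succ {w u : ℤ × ℤ × ℤ} {a b : Fin 4} (hab : b ≠ a)
    (hu : dot u u % 3 = 2) (ha : Perp3 w a) (hb : Perp3 w b) (ha' : Perp3 u a) (hb' : Perp3 u b)
    {k : ℕ} {E E' : ℤ × ℤ × ℤ} (hE : cross (turn3 a w) (turn3 a u) = (3 : ℤ) ^ k • E)
    (hE' : cross (turn3 b w) (turn3 b u) = (3 : ℤ) ^ k • E') :
    ∃ F : ℤ × ℤ × ℤ, cross w u = (3 : ℤ) ^ (k + 1) • F := by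
  have h3 : (3 : ℤ) ^ k ≠ 0 := by positivity
  have hD := turn3Mul_cross ha ha'
  have hD' := turn3Mul_cross hb hb'
  rw [hE, turn3Mul_smul] at hD
  rw [hE', turn3Mul_smul] at hD'
  have heq : turn3Mul a E = turn3Mul b E' := smul_right_injective _ h3 (hD.trans hD'.symm)
  have hEa : Perp3 E a := three_dvd_of_turn3Mul_eq hab heq
  have hEb : Perp3 E' b := three_dvd_of_turn3Mul_eq hab.symm heq.symm
  rw [← smul_turn3 hEa] at hD heq
  rw [← smul_turn3 hEb] at heq
  have heq' : turn3 a E = turn3 b E' := smul_right_injective _ (by decide : (3 : ℤ) ≠ 0) heq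
  have hF : cross w u = (3 : ℤ) ^ k • turn3 a E := by
    rw [smul_comm] at hD
    exact (smul_right_injective _ (by decide : (3 : ℤ) ≠ 0) hD).symm
  have h₀ : dot (turn3 a E) u = 0 := by
    have h₁ : dot (cross w u) u = 0 := by simp only [dot, cross]; ring
    have h₂ : dot (cross w u) u = 3 ^ k * dot (turn3 a E) u := by
      rw [hF]; simp only [dot, Prod.smul_fst, Prod.smul_snd, smul_eq_mul]; ring
    exact (mul_eq_zero.1 (h₂.symm.trans h₁)).resolve_left h3
  obtain ⟨G, hG⟩ := three_dvd_of_dot_eq_zero hab hu ha' hb' (perp3_turn3 hEa)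
    (heq' ▸ perp3_turn3 hEb) h₀
  exact ⟨G, by rw [hF, hG, smul_smul, pow_succ]⟩

theorem exists_cross_eq_pow {m : ℤ} (h3 : m % 3 = 2) (h7 : m % 7 ∈ ({3, 5, 6} : Finset ℤ))
    (hm : ∀ a b c : ℤ, 6 * a ^ 2 + 14 * b ^ 2 + 21 * c ^ 2 ≠ m) (k : ℕ) {w u : ℤ × ℤ × ℤ}
    (hw : Vertex m w) (hu : u ∈ stuck) (h : SameTurns 2 w u) (h' : ∀ j, Perp7 w j ↔ Perp7 u j) :
    ∃ F : ℤ × ℤ × ℤ, cross w u = (3 : ℤ) ^ k • F := by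
  induction k generalizing w u with
  | zero => exact ⟨cross w u, by simp⟩
  | succ k ih =>
    have step : ∀ i, Perp3 w i → ∃ E, cross (turn3 i w) (turn3 i u) = (3 : ℤ) ^ k • E := by
      intro i hi
      have hi' := (h.1 i).1 hi
      obtain ⟨v, hv, hv₁, hv₂⟩ := exists_stuck h3 h7 hm (hw.turn3 hi)
      obtain ⟨E, hE⟩ := ih (hw.turn3 hi) hv hv₁ hv₂
      have : v = turn3 i u ∨ v = -turn3 i u :=
        stuck_eq_or_eq_neg u hu v hv i hi' ((h.2 i hi).symm.trans hv₁.of_succ) fun j ↦ by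
          rw [perp7_turn3_iff hi', ← h', ← perp7_turn3_iff hi, hv₂]
      rcases this with rfl | rfl
      · exact ⟨E, hE⟩
      · refine ⟨-E, ?_⟩
        rw [smul_neg, ← hE]
        ext <;> simp [cross] <;> ring
    obtain ⟨a, b, hab, H⟩ := exists_perp3 (w := w) (by rwa [hw.2])
    have ha := (H a).2 (.inl rfl)
    have hb := (H b).2 (.inr rfl)
    obtain ⟨E, hE⟩ := step a ha
    obtain ⟨E', hE'⟩ := step b hb
    exact exists_cross_eq_pow_succ hab (dot_stuck u hu).1 ha hb ((h.1 a).1 ha) ((h.1 b).1 hb)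
      hE hE'

theorem eq_zero_of_forall_three_pow_dvd {x : ℤ} (h : ∀ k : ℕ, (3 : ℤ) ^ k ∣ x) : x = 0 := by
  by_contra hx
  have h₁ := Int.natAbs_dvd_natAbs.2 (h x.natAbs)
  rw [Int.natAbs_pow] at h₁
  exact (Nat.lt_pow_self (by decide : 1 < 3)).not_ge (Nat.le_of_dvd (Int.natAbs_pos.2 hx) h₁)

theorem stuck_dot : ∀ u ∈ stuck, (u.1 % 2 = 0 ∨ dot u u % 8 = 5 ∨ dot u u = 17) ∧
    ∃ a ∈ [0, -1, 1], ∃ b ∈ [0, 1, -1, 5, -5], ∃ c ∈ [0, 1, -1, 5, -5], dot u (a, b, c) = 1 := by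
  decide +kernel

theorem exists_repr_or_eq_seventeen_mul {m : ℤ} (h3 : m % 3 = 2) (h8 : m % 8 = 1)
    (h7 : m % 7 ∈ ({3, 5, 6} : Finset ℤ)) {w : ℤ × ℤ × ℤ} (hw : Vertex m w) :
    (∃ a b c : ℤ, 6 * a ^ 2 + 14 * b ^ 2 + 21 * c ^ 2 = m) ∨
      ∃ (t : ℤ) (u : ℤ × ℤ × ℤ), w = t • u ∧ m = 17 * t ^ 2 := by
  refine or_iff_not_imp_left.2 fun hm ↦ ?_
  push Not at hm
  obtain ⟨u, hu, h, h'⟩ := exists_stuck h3 h7 hm hw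
  have key : cross w u = 0 := by
    have H := fun k ↦ exists_cross_eq_pow h3 h7 hm k hw hu h h'
    refine Prod.ext ?_ (Prod.ext ?_ ?_) <;> refine eq_zero_of_forall_three_pow_dvd fun k ↦ ?_ <;>
      obtain ⟨F, hF⟩ := H k <;> rw [hF]
    exacts [⟨F.1, rfl⟩, ⟨F.2.1, rfl⟩, ⟨F.2.2, rfl⟩]
  obtain ⟨hu', a, -, b, -, c, -, hv⟩ := stuck_dot u hu
  obtain ⟨x, y, z⟩ := w
  obtain ⟨p, q, r⟩ := u
  simp only [cross, Prod.mk_eq_zero] at key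
  obtain ⟨k₁, k₂, k₃⟩ := key
  simp only [dot] at hv hu'
  have hw' : ((x, y, z) : ℤ × ℤ × ℤ) = dot (x, y, z) (a, b, c) • (p, q, r) := by
    simp only [dot, Prod.smul_mk, smul_eq_mul, Prod.mk.injEq]
    refine ⟨?_, ?_, ?_⟩
    · linear_combination (-x) * hv + b * k₃ - c * k₂
    · linear_combination (-y) * hv + c * k₁ - a * k₃
    · linear_combination (-z) * hv + a * k₂ - b * k₁
  generalize dot (x, y, z) (a, b, c) = t at hw'
  refine ⟨t, _, hw', ?_⟩
  obtain ⟨⟨o, -, -⟩, hn⟩ := hw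
  simp only [Prod.smul_mk, smul_eq_mul, Prod.mk.injEq] at hw'
  obtain ⟨rfl, rfl, rfl⟩ := hw'
  have hn' : m = (p * p + q * q + r * r) * t ^ 2 := by rw [← hn]; simp only [dot]; ring
  rcases hu' with h | h | h
  · simp only at o
    have : (t * p) % 2 = 0 := by rw [Int.mul_emod, h]; simp
    omega
  · exfalso
    have ho : t % 2 = 1 := by
      rcases Int.emod_two_eq_zero_or_one t with ht | ht
      · simp only at o
        have : (t * p) % 2 = 0 := by rw [Int.mul_emod, ht]; simp
        omega
      · exact ht
    have ht : t ^ 2 % 8 = 1 := by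
      have := Int.eight_dvd_sq_sub_one_of_odd (Int.odd_iff.2 ho)
      omega
    rw [hn', Int.mul_emod, h, ht] at h8
    omega
  · rw [hn', h]

theorem exists_repr_or_dvd {m a b c : ℤ} (h : a ^ 2 + b ^ 2 + c ^ 2 = m) (h3 : m % 3 = 2)
    (h8 : m % 8 = 1) (h7 : m % 7 ∈ ({3, 5, 6} : Finset ℤ)) :
    (∃ x y z : ℤ, 6 * x ^ 2 + 14 * y ^ 2 + 21 * z ^ 2 = m) ∨
      ∃ t : ℤ, m = 17 * t ^ 2 ∧ t ∣ a ∧ t ∣ b ∧ t ∣ c := by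
  have main : ∀ {a b c : ℤ}, a ^ 2 + b ^ 2 + c ^ 2 = m → a % 2 = 1 → b % 2 = 0 → c % 2 = 0 →
      (∃ x y z : ℤ, 6 * x ^ 2 + 14 * y ^ 2 + 21 * z ^ 2 = m) ∨
      ∃ t : ℤ, m = 17 * t ^ 2 ∧ t ∣ a ∧ t ∣ b ∧ t ∣ c := by
    intro a b c h ha hb hc
    have hw : Vertex m (a, b, c) := ⟨⟨ha, hb, hc⟩, by rw [← h]; simp only [dot]; ring⟩
    refine (exists_repr_or_eq_seventeen_mul h3 h8 h7 hw).imp_right ?_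
    rintro ⟨t, ⟨p, q, r⟩, hu, ht⟩
    simp only [Prod.smul_mk, smul_eq_mul, Prod.mk.injEq] at hu
    exact ⟨t, ht, ⟨p, hu.1⟩, ⟨q, hu.2.1⟩, ⟨r, hu.2.2⟩⟩
  have sq : ∀ x : ℤ, x % 2 = 0 ∧ x ^ 2 % 4 = 0 ∨ x % 2 = 1 ∧ x ^ 2 % 4 = 1 := fun x ↦ by
    rcases Int.emod_two_eq_zero_or_one x with hx | hx
    · obtain ⟨y, rfl⟩ := Int.dvd_of_emod_eq_zero hx
      exact .inl ⟨hx, by rw [mul_pow]; simp⟩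
    · exact .inr ⟨hx, Int.sq_mod_four_eq_one_of_odd (Int.odd_iff.2 hx)⟩
  rcases sq a with ⟨ha, ha'⟩ | ⟨ha, ha'⟩ <;> rcases sq b with ⟨hb, hb'⟩ | ⟨hb, hb'⟩ <;>
    rcases sq c with ⟨hc, hc'⟩ | ⟨hc, hc'⟩ <;> try omega
  · refine (main (a := c) (b := b) (c := a) (by linarith) hc hb ha).imp_right ?_
    rintro ⟨t, ht, h₁, h₂, h₃⟩
    exact ⟨t, ht, h₃, h₂, h₁⟩
  · refine (main (a := b) (b := a) (c := c) (by linarith) hb ha hc).imp_right ?_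
    rintro ⟨t, ht, h₁, h₂, h₃⟩
    exact ⟨t, ht, h₂, h₁, h₃⟩
  · exact main h ha hb hc

theorem eq_zero_or_eq_zero_of_dvd {p : ℕ} {a b c d : ℤ} (hp2 : IsCoprime (p : ℤ) 2)
    (h : a ^ 2 + b ^ 2 + c ^ 2 + d ^ 2 = p) (hdvd : (p : ℤ) ∣ a ^ 2 + b ^ 2 - c ^ 2 - d ^ 2) :
    a = 0 ∧ b = 0 ∨ c = 0 ∧ d = 0 := by
  have h₁ : (p : ℤ) ∣ 2 * (a ^ 2 + b ^ 2) := by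
    rw [show 2 * (a ^ 2 + b ^ 2) = (a ^ 2 + b ^ 2 - c ^ 2 - d ^ 2) + p by rw [← h]; ring]
    exact dvd_add hdvd dvd_rfl
  have h₂ : (p : ℤ) ∣ a ^ 2 + b ^ 2 := hp2.dvd_of_dvd_mul_left h₁
  rcases (show 0 ≤ a ^ 2 + b ^ 2 by positivity).eq_or_lt with h0 | h0
  · left
    constructor <;> nlinarith [sq_nonneg a, sq_nonneg b]
  · right
    have := Int.le_of_dvd h0 h₂
    constructor <;> nlinarith [sq_nonneg c, sq_nonneg d]

theorem exists_repr_seventeen_mul_sq {p : ℕ} (hp : p.Prime) (h2 : p ≠ 2) (h3 : p ≠ 3)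
    (h7 : p ≠ 7) : ∃ x y z : ℤ, 6 * x ^ 2 + 14 * y ^ 2 + 21 * z ^ 2 = 17 * (p : ℤ) ^ 2 := by
  by_contra hrep
  have hp2 : Odd (p : ℤ) := by exact_mod_cast hp.odd_of_ne_two h2
  have hp2' : IsCoprime (p : ℤ) 2 := by
    exact_mod_cast Nat.isCoprime_iff_coprime.2 (hp.odd_of_ne_two h2).coprime_two_right
  have mod8 : 17 * (p : ℤ) ^ 2 % 8 = 1 := by
    have := Int.eight_dvd_sq_sub_one_of_odd hp2
    lia
  have ndvd : ∀ q : ℕ, q.Prime → p ≠ q → (p : ℤ) % q ≠ 0 := fun q hq hpq h0 ↦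
    hpq ((Nat.prime_dvd_prime_iff_eq hq hp).1
      (Int.natCast_dvd_natCast.1 (Int.dvd_of_emod_eq_zero h0))).symm
  have mod3 : 17 * (p : ℤ) ^ 2 % 3 = 2 := by
    have h := ndvd 3 Nat.prime_three h3
    have h' : (p : ℤ) % 3 = 1 ∨ (p : ℤ) % 3 = 2 := by lia
    rcases h' with h' | h' <;> simp [Int.mul_emod, pow_two, h']
  have mod7 : 17 * (p : ℤ) ^ 2 % 7 ∈ ({3, 5, 6} : Finset ℤ) := by
    have h := ndvd 7 (by norm_num) h7
    have h' : (p : ℤ) % 7 = 1 ∨ (p : ℤ) % 7 = 2 ∨ (p : ℤ) % 7 = 3 ∨ (p : ℤ) % 7 = 4 ∨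
      (p : ℤ) % 7 = 5 ∨ (p : ℤ) % 7 = 6 := by lia
    rcases h' with h' | h' | h' | h' | h' | h' <;> simp [Int.mul_emod, pow_two, h']
  have hdvd : ∀ {x y z : ℤ}, x ^ 2 + y ^ 2 + z ^ 2 = 17 * (p : ℤ) ^ 2 →
      (p : ℤ) ∣ x ∧ (p : ℤ) ∣ y ∧ (p : ℤ) ∣ z := by
    intro x y z hxyz
    obtain ⟨t, ht, hx, hy, hz⟩ :=
      (exists_repr_or_dvd hxyz mod3 mod8 mod7).resolve_left hrep
    have : t ^ 2 = (p : ℤ) ^ 2 := by linarith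
    rcases sq_eq_sq_iff_eq_or_eq_neg.1 this with rfl | rfl
    · exact ⟨hx, hy, hz⟩
    · exact ⟨neg_dvd.1 hx, neg_dvd.1 hy, neg_dvd.1 hz⟩
  have hcop : ∀ {x : ℤ}, (p : ℤ) ∣ 8 * x → (p : ℤ) ∣ x := by
    intro x hx
    refine IsCoprime.dvd_of_dvd_mul_left ?_ hx
    rw [show (8 : ℤ) = 2 ^ 3 by norm_num]
    exact hp2'.pow_right
  obtain ⟨a, b, c, d, habcd⟩ := Nat.sum_four_squares p
  have hsum : (a : ℤ) ^ 2 + b ^ 2 + c ^ 2 + d ^ 2 = p := by exact_mod_cast habcd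
  obtain ⟨h₁, -, h₁'⟩ := hdvd
    (x := a ^ 2 + b ^ 2 - c ^ 2 - d ^ 2 + 4 * (2 * (b * d + a * c)))
    (y := 2 * (b * c + a * d) + 4 * (2 * (c * d - a * b)))
    (z := 2 * (b * d - a * c) + 4 * (a ^ 2 - b ^ 2 - c ^ 2 + d ^ 2)) (by rw [← hsum]; ring)
  obtain ⟨h₂, -, h₂'⟩ := hdvd
    (x := a ^ 2 + b ^ 2 - c ^ 2 - d ^ 2 - 4 * (2 * (b * d + a * c)))
    (y := 2 * (b * c + a * d) - 4 * (2 * (c * d - a * b)))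
    (z := 2 * (b * d - a * c) - 4 * (a ^ 2 - b ^ 2 - c ^ 2 + d ^ 2)) (by rw [← hsum]; ring)
  have hb : (p : ℤ) ∣ a ^ 2 + b ^ 2 - c ^ 2 - d ^ 2 := hcop (by
    have := (dvd_add h₁ h₂).mul_left 4
    ring_nf at this ⊢
    exact this)
  have hd : (p : ℤ) ∣ a ^ 2 + d ^ 2 - b ^ 2 - c ^ 2 := hcop (by
    have := dvd_sub h₁' h₂'
    ring_nf at this ⊢
    exact this)
  have not_sq : ∀ x : ℕ, (x : ℤ) ^ 2 ≠ p := fun x hx ↦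
    hp.not_isSquare ⟨x, by rw [← sq]; exact_mod_cast hx.symm⟩
  rcases eq_zero_or_eq_zero_of_dvd hp2' hsum hb with ⟨h₃, h₃'⟩ | ⟨h₃, h₃'⟩ <;>
    rcases eq_zero_or_eq_zero_of_dvd hp2' (by linarith) hd with ⟨h₄, h₄'⟩ | ⟨h₄, h₄'⟩ <;>
    simp only [h₃, h₃', h₄, h₄', ne_eq, OfNat.ofNat_ne_zero, not_false_eq_true, zero_pow, zero_add,
      add_zero] at hsum
  exacts [not_sq _ hsum, not_sq _ hsum, not_sq _ hsum, not_sq _ hsum]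

theorem exists_repr {n : ℤ} (hn : 0 ≤ n) :
    ∃ a b c : ℤ, 6 * a ^ 2 + 14 * b ^ 2 + 21 * c ^ 2 = 168 * n + 41 := by
  lift n to ℕ using hn
  obtain ⟨x, y, z, h⟩ :=
    UnimodularTernary.exists_three_sq_of_mod_eight_eq_one (n := 168 * n + 41) (by lia)
  push_cast at h
  rcases exists_repr_or_dvd h.symm (by lia) (by lia)
    (by rw [show (168 * n + 41 : ℤ) % 7 = 6 by lia]; decide) with hrep | ⟨t, ht, -⟩
  · exact hrep
  obtain ⟨p, hp, hpt⟩ := Nat.exists_prime_and_dvd (n := t.natAbs) (by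
    intro h1
    rw [← Int.natAbs_sq, h1] at ht
    lia)
  obtain ⟨s, rfl⟩ := Int.natCast_dvd.2 hpt
  obtain ⟨a, b, c, habc⟩ := exists_repr_seventeen_mul_sq hp
    (by rintro rfl; push_cast at ht; lia)
    (by rintro rfl; push_cast at ht; lia) (by rintro rfl; push_cast at ht; lia)
  exact ⟨s * a, s * b, s * c, by rw [ht]; linear_combination s ^ 2 * habc⟩

theorem modEq_of_repr {n a b c : ℤ} (h : 6 * a ^ 2 + 14 * b ^ 2 + 21 * c ^ 2 = 168 * n + 41) :
    a ≡ 1 [ZMOD 2] ∧ b ≡ 1 [ZMOD 2] ∧ c ≡ 1 [ZMOD 2] ∧ ¬ (b ≡ 0 [ZMOD 3]) ∧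
      (a ≡ 1 [ZMOD 7] ∨ a ≡ -1 [ZMOD 7]) := by
  have sq2 : ∀ x : ℤ, x % 2 = 0 ∧ x ^ 2 % 4 = 0 ∨ x % 2 = 1 ∧ x ^ 2 % 8 = 1 := fun x ↦ by
    rcases Int.emod_two_eq_zero_or_one x with hx | hx
    · obtain ⟨y, rfl⟩ := Int.dvd_of_emod_eq_zero hx
      exact .inl ⟨hx, by rw [mul_pow]; simp⟩
    · have := Int.eight_dvd_sq_sub_one_of_odd (Int.odd_iff.2 hx)
      exact .inr ⟨hx, by lia⟩
  simp only [Int.ModEq]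
  refine ⟨?_, ?_, ?_, ?_, ?_⟩
  · rcases sq2 a with ⟨ha, ha'⟩ | ⟨ha, ha'⟩ <;> rcases sq2 b with ⟨hb, hb'⟩ | ⟨hb, hb'⟩ <;>
      rcases sq2 c with ⟨hc, hc'⟩ | ⟨hc, hc'⟩ <;> lia
  · rcases sq2 a with ⟨ha, ha'⟩ | ⟨ha, ha'⟩ <;> rcases sq2 b with ⟨hb, hb'⟩ | ⟨hb, hb'⟩ <;>
      rcases sq2 c with ⟨hc, hc'⟩ | ⟨hc, hc'⟩ <;> lia
  · rcases sq2 c with ⟨hc, hc'⟩ | ⟨hc, hc'⟩ <;> lia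
  · intro hb
    obtain ⟨y, rfl⟩ := Int.dvd_of_emod_eq_zero hb
    lia
  · have ha : a % 7 = 0 ∨ a % 7 = 1 ∨ a % 7 = 2 ∨ a % 7 = 3 ∨ a % 7 = 4 ∨ a % 7 = 5 ∨
      a % 7 = 6 := by lia
    have hsq : a ^ 2 % 7 = 1 := by lia
    rw [pow_two, Int.mul_emod] at hsq
    rcases ha with ha | ha | ha | ha | ha | ha | ha <;> rw [ha] at hsq ⊢ <;> simp at hsq ⊢

end TernaryWalk

/-- For every non negative integer `n`, the equation
`6x² + 14y² + 21z² = 168n + 41` has an integer solution `(a,b,c)`; moreover,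
any such solution satisfies `a ≡ b ≡ c ≡ 1 (mod 2)`, `b ≢ 0 (mod 3)` and
`a ≡ ±1 (mod 7)`. -/
theorem rep_168n_41_by_f_with_conditions (n : ℤ) (hn : 0 ≤ n) :
    (∃ a b c : ℤ, 6 * a ^ 2 + 14 * b ^ 2 + 21 * c ^ 2 = 168 * n + 41) ∧
    (∀ a b c : ℤ,
        6 * a ^ 2 + 14 * b ^ 2 + 21 * c ^ 2 = 168 * n + 41 →
          a ≡ 1 [ZMOD 2] ∧ b ≡ 1 [ZMOD 2] ∧ c ≡ 1 [ZMOD 2] ∧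
          ¬ (b ≡ 0 [ZMOD 3]) ∧
          (a ≡ 1 [ZMOD 7] ∨ a ≡ -1 [ZMOD 7])) :=
  ⟨TernaryWalk.exists_repr hn, fun _ _ _ h ↦ TernaryWalk.modEq_of_repr h⟩
end
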